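/- arXiv:1904.07219 — 8 statements merged into one kernel-verified Lean document; each statement's English description precedes it below -/
import Mathlib

section
/- Let T be a (finite) tree and r ≥ 1 an integer, and let T[r] denote the blow-up of T in which every vertex is replaced by an independent set of r vertices and the copies of two vertices are adjacent if and only if the original vertices are adjacent in T. Then there exists a constant C (depending only on T and r) such that for all n, ex(n, T[r]) ≤ C · n^{2 - 1/r}. -/
/-- `F` is contained in `G` as a subgraph, i.e. there is an injective graph
homomorphism from `F` to `G`. -/
def ContainsCopy {α : Type*} {β : Type*} (F : SimpleGraph α) (G : SimpleGraph β) : Prop :=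
  ∃ f : α → β, Function.Injective f ∧ ∀ ⦃a b⦄, F.Adj a b → G.Adj (f a) (f b)

/-- The blow-up `T[r]` of a graph `T`: every vertex is replaced by an independent set
of `r` vertices, and copies of two vertices are adjacent iff the originals are. -/
def blowup {V : Type*} (T : SimpleGraph V) (r : ℕ) : SimpleGraph (V × Fin r) :=
  SimpleGraph.comap Prod.fst T

open Finset

/-- If the thresholds `t` sum to less than half the total degree of a symmetric relation, some
nonempty vertex set induces degrees at least `t`. -/
theorem exists_nonempty_forall_le_card_filter {X : Type*} [Fintype X] [DecidableEq X]
    (R : X → X → Prop) [DecidableRel R] (hR : ∀ ⦃x y⦄, R x y → R y x) (t : X → ℝ)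
    (ht : 2 * ∑ x, t x < ∑ x, (#{y | R x y} : ℝ)) :
    ∃ S : Finset X, S.Nonempty ∧ ∀ x ∈ S, t x ≤ #{y ∈ S | R x y} := by
  let φ : Finset X → ℝ := fun S ↦ ∑ x ∈ S, (#{y ∈ S | R x y} : ℝ) - 2 * ∑ x ∈ S, t x
  obtain ⟨S, -, hS⟩ := exists_max_image (univ : Finset (Finset X)) φ ⟨∅, mem_univ _⟩
  refine ⟨S, ?_, fun x hx ↦ ?_⟩
  · rw [nonempty_iff_ne_empty]
    rintro rfl
    have := hS univ (mem_univ _)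
    simp only [φ, sum_empty] at this
    linarith
  · by_contra! hlt
    have hmax := hS (S.erase x) (mem_univ _)
    have hsum : ∀ f : X → ℝ, ∑ y ∈ S, f y = f x + ∑ y ∈ S.erase x, f y :=
      fun f ↦ (add_sum_erase S f hx).symm
    have hdeg : ∀ y, (#{z ∈ S | R y z} : ℝ) =
        (if R y x then 1 else 0) + #{z ∈ S.erase x | R y z} := by
      intro y
      rw [card_filter, card_filter]
      push_cast
      exact hsum _
    have hback : ∑ y ∈ S.erase x, (if R y x then (1 : ℝ) else 0) ≤ #{y ∈ S | R x y} := by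
      rw [sum_boole]
      norm_cast
      refine card_le_card fun y hy ↦ ?_
      simp only [mem_filter, mem_erase] at hy ⊢
      exact ⟨hy.1.2, hR hy.2⟩
    have hdegS : ∑ y ∈ S.erase x, (#{z ∈ S | R y z} : ℝ) =
        ∑ y ∈ S.erase x, (if R y x then (1 : ℝ) else 0) +
          ∑ y ∈ S.erase x, (#{z ∈ S.erase x | R y z} : ℝ) := by
      rw [← sum_add_distrib]
      exact sum_congr rfl fun y _ ↦ hdeg y
    simp only [φ] at hmax
    rw [hsum, hsum t, hdegS] at hmax
    linarith

/-- Tuples in `N` one of whose coordinates is determined by the others number at most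
`|N| ^ k`. -/
theorem card_le_pow_of_coord_eq {β : Type*} {k : ℕ} (N : Finset β)
    (F : Finset (Fin (k + 1) → β)) (hF : ∀ y ∈ F, ∀ i, y i ∈ N) (i : Fin (k + 1))
    (g : (Fin k → β) → β) (hg : ∀ y ∈ F, y i = g (i.removeNth y)) :
    #F ≤ #N ^ k := by
  classical
  rw [← Fintype.card_piFinset_const]
  refine card_le_card_of_injOn i.removeNth (fun y hy ↦ ?_) fun y hy z hz hyz ↦ ?_
  · simp only [mem_coe, Fintype.mem_piFinset]
    exact fun j ↦ hF y hy _
  · rw [← i.insertNth_self_removeNth y, ← i.insertNth_self_removeNth z, hg y hy, hg z hz, hyz]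

/-- A large family of tuples in `N` contains an injective one avoiding a given set. -/
theorem exists_injective_avoiding {β : Type*} {k : ℕ} (N U : Finset β)
    (F : Finset (Fin (k + 1) → β)) (hF : ∀ y ∈ F, ∀ i, y i ∈ N)
    (hcard : (k + 1) * ((k + 1) + #U) * #N ^ k < #F) :
    ∃ y ∈ F, Function.Injective y ∧ ∀ i, y i ∉ U := by
  classical
  by_contra! hbad
  have hcover : F ⊆ univ.biUnion fun i : Fin (k + 1) ↦
      (univ.biUnion fun j : Fin k ↦ {y ∈ F | y i = y (i.succAbove j)}) ∪
        U.biUnion fun u ↦ {y ∈ F | y i = u} := by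
    intro y hy
    simp only [mem_biUnion, mem_union, mem_filter, mem_univ, true_and]
    by_cases hinj : Function.Injective y
    · obtain ⟨i, hi⟩ := hbad y hy hinj
      exact ⟨i, Or.inr ⟨_, hi, hy, rfl⟩⟩
    · simp only [Function.Injective, not_forall] at hinj
      obtain ⟨i, j, hij, hne⟩ := hinj
      obtain ⟨l, rfl⟩ := Fin.exists_succAbove_eq (Ne.symm hne)
      exact ⟨i, Or.inl ⟨l, hy, hij⟩⟩
  have hle : #F ≤ (k + 1) * ((k + #U) * #N ^ k) := by
    refine (card_le_card hcover).trans ?_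
    refine (card_biUnion_le_card_mul _ _ ((k + #U) * #N ^ k) fun i _ ↦ ?_).trans (by simp)
    refine (card_union_le _ _).trans ?_
    rw [add_mul]
    refine add_le_add ?_ ?_
    · refine (card_biUnion_le_card_mul _ _ (#N ^ k) fun j _ ↦ ?_).trans (by simp)
      exact card_le_pow_of_coord_eq N _ (fun y hy ↦ hF y (mem_filter.1 hy).1) i (fun z ↦ z j)
        fun y hy ↦ (mem_filter.1 hy).2
    · refine card_biUnion_le_card_mul _ _ (#N ^ k) fun u _ ↦ ?_
      exact card_le_pow_of_coord_eq N _ (fun y hy ↦ hF y (mem_filter.1 hy).1) i (fun _ ↦ u)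
        fun y hy ↦ (mem_filter.1 hy).2
  have : (k + 1) * ((k + #U) * #N ^ k) ≤ (k + 1) * ((k + 1) + #U) * #N ^ k := by
    rw [mul_assoc]
    gcongr
    omega
  omega

/-- Greedy embedding of a tree: if every tuple in `S` has, for each small set `U`, an injective
neighbour in `S` avoiding `U`, then the tree embeds with pairwise disjoint tuples. -/
theorem exists_tree_embedding {β : Type*} {r M : ℕ} (R : (Fin r → β) → (Fin r → β) → Prop)
    (hR : ∀ ⦃x y⦄, R x y → R y x) (S : Finset (Fin r → β)) (hS : S.Nonempty)
    (hext : ∀ x ∈ S, ∀ U : Finset β, #U ≤ M →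
      ∃ y ∈ S, R x y ∧ Function.Injective y ∧ ∀ i, y i ∉ U)
    (m : ℕ) (V : Type) [Fintype V] (T : SimpleGraph V) (hT : T.IsTree)
    (hm : Fintype.card V = m + 1) (hM : m * r ≤ M) :
    ∃ f : V → Fin r → β, (∀ v, f v ∈ S) ∧ Function.Injective (Function.uncurry f) ∧
      ∀ ⦃u v⦄, T.Adj u v → R (f u) (f v) := by
  classical
  induction m generalizing V with
  | zero =>
    obtain ⟨x, hx⟩ := hS
    obtain ⟨y, hy, -, hinj, -⟩ := hext x hx ∅ (by simp)
    have : Subsingleton V := Fintype.card_le_one_iff_subsingleton.1 (by omega)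
    refine ⟨fun _ ↦ y, fun _ ↦ hy, ?_, fun u v huv ↦ ?_⟩
    · rintro ⟨u, i⟩ ⟨v, j⟩ h
      exact Prod.ext (Subsingleton.elim _ _) (hinj h)
    · exact absurd (Subsingleton.elim u v) huv.ne
  | succ m ih =>
    have : Nontrivial V := Fintype.one_lt_card_iff_nontrivial.1 (by omega)
    obtain ⟨v, hv⟩ := hT.exists_vert_degree_one_of_nontrivial
    have hT' : (T.induce {v}ᶜ).IsTree :=
      ⟨hT.connected.induce_compl_singleton_of_degree_eq_one hv, hT.isAcyclic.induce _⟩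
    have hcard : Fintype.card ({v}ᶜ : Set V) = m + 1 := by
      rw [Fintype.card_compl_set, hm]
      simp
    obtain ⟨f, hfS, hfinj, hfadj⟩ := ih _ _ hT' hcard (by nlinarith)
    obtain ⟨w, hw, huniq⟩ := SimpleGraph.degree_eq_one_iff_existsUnique_adj.1 hv
    have hwv : w ∈ ({v}ᶜ : Set V) := hw.ne'
    obtain ⟨y, hyS, hRy, hyinj, hyU⟩ := hext (f ⟨w, hwv⟩) (hfS _)
      (univ.image (Function.uncurry f)) <| card_image_le.trans <| by
        rw [card_univ, Fintype.card_prod, hcard, Fintype.card_fin]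
        exact hM
    have hy : ∀ i u j, y i ≠ f u j := fun i u j h ↦
      hyU i (mem_image.2 ⟨(u, j), mem_univ _, h.symm⟩)
    refine ⟨fun u ↦ if h : u ∈ ({v}ᶜ : Set V) then f ⟨u, h⟩ else y, fun u ↦ ?_, ?_, ?_⟩
    · dsimp only
      split_ifs
      exacts [hfS _, hyS]
    · rintro ⟨a, i⟩ ⟨b, j⟩ h
      simp only [Function.uncurry_apply_pair] at h
      split_ifs at h with ha hb hb
      · have := hfinj (a₁ := (⟨a, ha⟩, i)) (a₂ := (⟨b, hb⟩, j)) h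
        simpa using this
      · exact absurd h.symm (hy _ _ _)
      · exact absurd h (hy _ _ _)
      · simp only [Set.mem_compl_iff, Set.mem_singleton_iff, not_not] at ha hb
        rw [ha, hb, hyinj h]
    · intro a b hab
      dsimp only
      split_ifs with ha hb hb
      · exact hfadj hab
      · simp only [Set.mem_compl_iff, Set.mem_singleton_iff, not_not] at hb
        subst hb
        obtain rfl := huniq a hab.symm
        exact hRy
      · simp only [Set.mem_compl_iff, Set.mem_singleton_iff, not_not] at ha
        subst ha
        obtain rfl := huniq b hab
        exact hR hRy
      · simp only [Set.mem_compl_iff, Set.mem_singleton_iff, not_not] at ha hb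
        exact absurd (ha.trans hb.symm) hab.ne

/-- Double counting of stars with `r` leaves. -/
theorem sum_card_common_neighbors {β : Type*} [Fintype β] [DecidableEq β] (G : SimpleGraph β)
    [DecidableRel G.Adj] (r : ℕ) :
    ∑ x : Fin r → β, #{v | ∀ i, G.Adj (x i) v} = ∑ v, G.degree v ^ r := by
  have h := sum_card_bipartiteAbove_eq_sum_card_bipartiteBelow
    (s := (univ : Finset (Fin r → β))) (t := univ) fun x v ↦ ∀ i, G.Adj (x i) v
  simp only [bipartiteAbove, bipartiteBelow] at h
  rw [h]
  refine sum_congr rfl fun v _ ↦ ?_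
  rw [← G.card_neighborFinset_eq_degree, ← Fintype.card_piFinset_const]
  congr 1
  ext x
  simp [G.adj_comm]

/-- Two applications of the power mean inequality bound the number of homomorphisms of
`K_{k+1,k+1}` from below. -/
theorem lt_sum_card_common_neighbors_pow {n k : ℕ} (G : SimpleGraph (Fin n))
    [DecidableRel G.Adj] (hn : 0 < n) {K : ℝ} (hK : 0 ≤ K)
    (h : K * (n : ℝ) ^ (2 * k + 1) < (2 * #G.edgeFinset : ℝ) ^ (k + 1)) :
    K ^ (k + 1) * (n : ℝ) ^ (k + 1) <
      ∑ x : Fin (k + 1) → Fin n, (#{v | ∀ i, G.Adj (x i) v} : ℝ) ^ (k + 1) := by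
  have hn' : (0 : ℝ) < n := by exact_mod_cast hn
  have hdeg : (∑ v, (G.degree v : ℝ)) = 2 * #G.edgeFinset := by
    exact_mod_cast G.sum_degrees_eq_twice_card_edges
  have h₁ : (2 * #G.edgeFinset : ℝ) ^ (k + 1) ≤
      n ^ k * ∑ v, (G.degree v : ℝ) ^ (k + 1) := by
    have := pow_sum_le_card_mul_sum_pow (s := (univ : Finset (Fin n)))
      (f := fun v ↦ (G.degree v : ℝ)) (fun _ _ ↦ by positivity) k
    rwa [hdeg, card_univ, Fintype.card_fin] at this
  have hcount : ∑ x : Fin (k + 1) → Fin n, (#{v | ∀ i, G.Adj (x i) v} : ℝ) =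
      ∑ v, (G.degree v : ℝ) ^ (k + 1) := by
    exact_mod_cast sum_card_common_neighbors G (k + 1)
  have h₂ : K * (n : ℝ) ^ (k + 1) <
      ∑ x : Fin (k + 1) → Fin n, (#{v | ∀ i, G.Adj (x i) v} : ℝ) := by
    rw [hcount]
    refine lt_of_mul_lt_mul_left (lt_of_eq_of_lt ?_ (h.trans_le h₁)) (by positivity)
    ring
  have h₃ := pow_sum_le_card_mul_sum_pow (s := (univ : Finset (Fin (k + 1) → Fin n)))
      (f := fun x ↦ (#{v | ∀ i, G.Adj (x i) v} : ℝ)) (fun _ _ ↦ by positivity) k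
  have h₄ := (pow_lt_pow_left₀ h₂ (by positivity) (n := k + 1) (by omega)).trans_le h₃
  simp only [card_univ, Fintype.card_pi, Fintype.card_fin, prod_const, Nat.cast_pow] at h₄
  refine lt_of_mul_lt_mul_left (lt_of_eq_of_lt ?_ h₄)
    (by positivity : (0 : ℝ) ≤ ((n : ℝ) ^ (k + 1)) ^ k)
  ring

/-- A graph with many homomorphisms from `K_{k+1,k+1}` contains the blow-up of a tree. -/
theorem containsCopy_blowup_of_lt_sum {V : Type} [Fintype V] (T : SimpleGraph V)
    (hT : T.IsTree) {n k : ℕ} (G : SimpleGraph (Fin n)) [DecidableRel G.Adj] (L : ℕ)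
    (hL : 4 * ((k + 1) * ((k + 1) + Fintype.card V * (k + 1))) < L)
    (h : 4 * (L : ℝ) ^ (k + 1) * (n : ℝ) ^ (k + 1) <
      ∑ x : Fin (k + 1) → Fin n, (#{v | ∀ i, G.Adj (x i) v} : ℝ) ^ (k + 1)) :
    ContainsCopy (blowup T (k + 1)) G := by
  classical
  let R : (Fin (k + 1) → Fin n) → (Fin (k + 1) → Fin n) → Prop :=
    fun x y ↦ ∀ j i, G.Adj (x i) (y j)
  have hR : ∀ ⦃x y⦄, R x y → R y x := fun x y hxy j i ↦ (hxy i j).symm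
  let N : (Fin (k + 1) → Fin n) → Finset (Fin n) := fun x ↦ {v | ∀ i, G.Adj (x i) v}
  have hRN : ∀ x, ({y | R x y} : Finset _) = Fintype.piFinset fun _ ↦ N x := by
    intro x
    ext y
    simp [R, N]
  have hRcard : ∀ x, (#{y | R x y} : ℝ) = (#(N x) : ℝ) ^ (k + 1) := by
    intro x
    rw [hRN, Fintype.card_piFinset_const]
    push_cast
    rfl
  obtain ⟨S, hS, hdeg⟩ := exists_nonempty_forall_le_card_filter R hR
    (fun x ↦ (#(N x) : ℝ) ^ (k + 1) / 4 + (L : ℝ) ^ (k + 1)) (by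
      simp only [hRcard, sum_add_distrib, ← sum_div, sum_const, card_univ, Fintype.card_pi,
        Fintype.card_fin, prod_const, nsmul_eq_mul, Nat.cast_pow]
      change _ < ∑ x, (#(N x) : ℝ) ^ (k + 1) at h
      linarith)
  have := hT.connected.nonempty
  obtain ⟨m, hm⟩ : ∃ m, Fintype.card V = m + 1 :=
    Nat.exists_eq_succ_of_ne_zero Fintype.card_ne_zero
  obtain ⟨f, -, hinj, hadj⟩ := exists_tree_embedding (M := Fintype.card V * (k + 1)) R hR S hS
    (fun x hx U hU ↦ by
      have hx' := hdeg x hx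
      have hle : (#{y ∈ S | R x y} : ℝ) ≤ (#(N x) : ℝ) ^ (k + 1) := by
        rw [← hRcard]
        exact_mod_cast card_le_card (filter_subset_filter _ (subset_univ S))
      have hLN : (L : ℝ) ≤ #(N x) := by
        refine le_of_pow_le_pow_left₀ (n := k + 1) (by omega) (by positivity) ?_
        have : (0 : ℝ) ≤ (#(N x) : ℝ) ^ (k + 1) := by positivity
        linarith
      have hbig : (k + 1) * ((k + 1) + #U) * #(N x) ^ k < #{y ∈ S | R x y} := by
        have h₁ : 4 * ((k + 1) * ((k + 1) + #U)) ≤ #(N x) := by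
          have : (k + 1) * ((k + 1) + #U) ≤
            (k + 1) * ((k + 1) + Fintype.card V * (k + 1)) := by gcongr
          have : L ≤ #(N x) := by exact_mod_cast hLN
          omega
        have h₂ : 4 * ((k + 1) * ((k + 1) + #U) * #(N x) ^ k) ≤ #(N x) ^ (k + 1) := by
          calc _ = 4 * ((k + 1) * ((k + 1) + #U)) * #(N x) ^ k := by ring
            _ ≤ #(N x) * #(N x) ^ k := by gcongr
            _ = _ := by ring
        have hL0 : (0 : ℝ) < (L : ℝ) ^ (k + 1) := by
          have : 0 < L := by omega
          positivity
        have h₃ : (4 * ((k + 1) * ((k + 1) + #U) * #(N x) ^ k : ℕ) : ℝ) ≤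
          (#(N x) : ℝ) ^ (k + 1) := by exact_mod_cast h₂
        rw [← Nat.cast_lt (α := ℝ)]
        linarith
      obtain ⟨y, hy, hyinj, hyU⟩ := exists_injective_avoiding (N x) U {y ∈ S | R x y}
        (fun y hy i ↦ by simpa [N] using (mem_filter.1 hy).2 i) hbig
      exact ⟨y, (mem_filter.1 hy).1, (mem_filter.1 hy).2, hyinj, hyU⟩)
    m V T hT hm (by gcongr; omega)
  exact ⟨Function.uncurry f, hinj, fun a b hab ↦ hadj hab _ _⟩

/-- **Turán numbers of blow-ups of trees** (Grósz–Janzer–Nagy, Theorem 4).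
If `T` is a tree and `r ≥ 1`, then `ex(n, T[r]) = O(n^{2 - 1/r})`. -/
theorem tree_blowup_turan {V : Type} [Fintype V] (T : SimpleGraph V) (hT : T.IsTree)
    (r : ℕ) (hr : 1 ≤ r) :
    ∃ C : ℝ, ∀ (n : ℕ) (G : SimpleGraph (Fin n)) [DecidableRel G.Adj],
      ¬ ContainsCopy (blowup T r) G →
      (G.edgeFinset.card : ℝ) ≤ C * (n : ℝ) ^ (2 - 1 / (r : ℝ)) := by
  obtain ⟨k, rfl⟩ : ∃ k, r = k + 1 := ⟨r - 1, by omega⟩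
  obtain ⟨L, hL⟩ := exists_gt (4 * ((k + 1) * ((k + 1) + Fintype.card V * (k + 1))))
  have hL1 : (1 : ℝ) ≤ L := by
    have : 1 ≤ L := by omega
    exact_mod_cast this
  refine ⟨4 * L, fun n G _ hG ↦ ?_⟩
  contrapose! hG
  obtain rfl | hn := n.eq_zero_or_pos
  · have : #G.edgeFinset = 0 := by
      rw [card_eq_zero, SimpleGraph.edgeFinset_eq_empty]
      exact Subsingleton.elim _ _
    rw [this, Nat.cast_zero] at hG
    exact absurd hG (not_lt.2 (by positivity))
  have hpow : ((n : ℝ) ^ (2 - 1 / ((k + 1 : ℕ) : ℝ))) ^ (k + 1) = (n : ℝ) ^ (2 * k + 1) := by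
    rw [← Real.rpow_natCast, ← Real.rpow_mul (by positivity), ← Real.rpow_natCast]
    congr 1
    push_cast
    field_simp
    ring
  refine containsCopy_blowup_of_lt_sum T hT G L hL
    (lt_of_le_of_lt ?_ (lt_sum_card_common_neighbors_pow G hn (K := 4 * L) (by positivity) ?_))
  · rw [mul_pow]
    gcongr
    exact le_self_pow₀ (by norm_num) k.succ_ne_zero
  · rw [← hpow]
    calc 4 * (L : ℝ) * ((n : ℝ) ^ (2 - 1 / ((k + 1 : ℕ) : ℝ))) ^ (k + 1)
        ≤ (4 * L) ^ (k + 1) * ((n : ℝ) ^ (2 - 1 / ((k + 1 : ℕ) : ℝ))) ^ (k + 1) := by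
          gcongr
          exact le_self_pow₀ (by linarith) k.succ_ne_zero
      _ = (4 * L * (n : ℝ) ^ (2 - 1 / ((k + 1 : ℕ) : ℝ))) ^ (k + 1) := (mul_pow _ _ _).symm
      _ < (2 * #G.edgeFinset : ℝ) ^ (k + 1) := by
          refine pow_lt_pow_left₀ (hG.trans_le ?_) (by positivity) k.succ_ne_zero
          have : (0 : ℝ) ≤ #G.edgeFinset := by positivity
          linarith
end

section
/- Let r ≥ 1 be an integer and let F be a graph that is r-degenerate and is a blow-up of a (finite) tree T. Then there exists a constant C (depending only on F) such that for all n, ex(n, F) ≤ C · n^{2 - 1/r}. -/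
/-- A graph is `r`-degenerate if every nonempty subgraph has a vertex of degree
at most `r`. -/
def Degenerate (r : ℕ) {V : Type*} (F : SimpleGraph V) : Prop :=
  ∀ H : F.Subgraph, H.verts.Nonempty → ∃ v ∈ H.verts, (H.neighborSet v).ncard ≤ r

/-- `F` is a blow-up of the graph `T`: it is obtained from `T` by replacing each
vertex `u` of `T` with a (finite) nonempty independent set `I(u)` (the fiber of the
projection `π` over `u`) and each edge `uv` with a complete bipartite graph between
`I(u)` and `I(v)`. -/
def IsBlowupOf {W V : Type*} (F : SimpleGraph W) (T : SimpleGraph V) : Prop :=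
  ∃ π : W → V, Function.Surjective π ∧ ∀ w w', F.Adj w w' ↔ T.Adj (π w) (π w')


section Embedding

open Finset

variable {W α V : Type*} [DecidableEq W] [DecidableEq α]

/-- An injective map on `S` extends to a further finite set `Y`, with values in a prescribed set
that is large enough and avoids the image of `S`. -/
theorem exists_injOn_extension {φ : W → α} {S Y : Finset W} {t : Finset α}
    (hφ : Set.InjOn φ S) (hYS : Disjoint Y S) (hcard : #Y ≤ #t) (ht : Disjoint t (S.image φ)) :
    ∃ ψ : W → α, (∀ w ∈ S, ψ w = φ w) ∧ Set.InjOn ψ (S ∪ Y : Finset W) ∧ ∀ w ∈ Y, ψ w ∈ t := by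
  obtain ⟨g⟩ : Nonempty (Y ↪ t) := Function.Embedding.nonempty_of_card_le (by simpa using hcard)
  have hS : ∀ w ∈ S, (if h : w ∈ Y then (g ⟨w, h⟩ : α) else φ w) = φ w := fun w hw ↦
    dif_neg fun h ↦ disjoint_left.1 hYS h hw
  have hne : ∀ x ∈ S, ∀ y (hy : y ∈ Y), φ x ≠ g ⟨y, hy⟩ := fun x hx y hy h ↦
    disjoint_left.1 ht (g ⟨y, hy⟩).2 (h ▸ mem_image_of_mem φ hx)
  refine ⟨fun w ↦ if h : w ∈ Y then (g ⟨w, h⟩ : α) else φ w, hS, ?_, ?_⟩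
  · intro x hx y hy hxy
    simp only [coe_union, Set.mem_union, mem_coe] at hx hy
    rcases hx with hx | hx <;> rcases hy with hy | hy <;> simp only [hS, hx, hy] at hxy
    · exact hφ hx hy hxy
    · exact absurd hxy (hne x hx y hy)
    · exact absurd hxy.symm (hne y hy x hx)
    · simpa using g.injective (Subtype.ext hxy)
  · intro w hw
    simp [hw]

/-- A nonempty symmetric family of pairs of completely joined `r`-sets with at least `K` common
neighbours each, in which every subset `a` of a member is contained in a member of a pair that
otherwise avoids any given set of at most `m` vertices. -/
structure IsRichFamily (G : SimpleGraph α) (r m K : ℕ) (R : Finset α → Finset α → Prop) :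
    Prop where
  nonempty : ∃ A B, R A B
  symm : ∀ ⦃A B⦄, R A B → R B A
  card_eq : ∀ ⦃A B⦄, R A B → #A = r
  adj : ∀ ⦃A B⦄, R A B → ∀ x ∈ A, ∀ y ∈ B, G.Adj x y
  exists_common : ∀ ⦃A B⦄, R A B → ∃ N : Finset α, K ≤ #N ∧ ∀ x ∈ A, ∀ y ∈ N, G.Adj x y
  exists_fresh : ∀ ⦃A B⦄, R A B → ∀ a ⊆ A, ∀ Z : Finset α, #Z ≤ m →
    ∃ A' B', R A' B' ∧ a ⊆ A' ∧ Disjoint (A' \ a) Z ∧ Disjoint B' Z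

omit [DecidableEq W] in
theorem IsRichFamily.mono {G : SimpleGraph α} {r m K K' : ℕ} {R : Finset α → Finset α → Prop}
    (hR : IsRichFamily G r m K R) (hK : K' ≤ K) : IsRichFamily G r m K' R where
  __ := hR
  exists_common _ _ h := (hR.exists_common h).imp fun _ hN ↦ ⟨hK.trans hN.1, hN.2⟩

/-- A partial embedding extends to a complete bipartite graph with parts `X` and `Y`, provided
that only a part `Q` of `X` has been embedded, into a member of the rich family. -/
theorem IsRichFamily.exists_extension {G : SimpleGraph α} {r m K : ℕ}
    {R : Finset α → Finset α → Prop} (hR : IsRichFamily G r m K R)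
    {φ : W → α} {S X Y Q : Finset W} (hφ : Set.InjOn φ S) (hSm : #S ≤ m) (hK : m + #Y ≤ K)
    (hXr : #X ≤ r) (hQX : Q ⊆ X) (hQS : Q ⊆ S) (hXS : X ∩ S ⊆ Q) (hYS : Disjoint Y S)
    (hXY : Disjoint X Y) {A B : Finset α} (hAB : R A B) (hQA : Q.image φ ⊆ A) :
    ∃ ψ : W → α, (∀ w ∈ S, ψ w = φ w) ∧ Set.InjOn ψ (S ∪ X ∪ Y : Finset W) ∧
      (∀ x ∈ X, ∀ y ∈ Y, G.Adj (ψ x) (ψ y)) ∧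
      ∃ A' B', R A' B' ∧ (∀ x ∈ X, ψ x ∈ A') ∧ (#Y ≤ r → ∀ y ∈ Y, ψ y ∈ B') := by
  obtain ⟨A', B', hAB', hQA', hA', hB'⟩ :=
    hR.exists_fresh hAB _ hQA (S.image φ) (card_image_le.trans hSm)
  have hQcard : #(Q.image φ) = #Q := card_image_of_injOn (hφ.mono (by simpa using hQS))
  obtain ⟨φ₁, h₁S, h₁inj, h₁X⟩ := exists_injOn_extension (Y := X \ Q) (t := A' \ Q.image φ) hφ
    (by rw [disjoint_left]; intro w hw hwS
        rw [mem_sdiff] at hw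
        exact hw.2 (hXS (mem_inter.2 ⟨hw.1, hwS⟩)))
    (by rw [card_sdiff_of_subset hQX, card_sdiff_of_subset hQA', hR.card_eq hAB', hQcard]
        omega) hA'
  have hSX : S ∪ X \ Q = S ∪ X := by
    ext w
    simp only [mem_union, mem_sdiff]
    have := @hQS w
    tauto
  rw [hSX] at h₁inj
  have h₁A : ∀ x ∈ X, φ₁ x ∈ A' := by
    intro x hx
    by_cases hxQ : x ∈ Q
    · rw [h₁S x (hQS hxQ)]
      exact hQA' (mem_image_of_mem φ hxQ)
    · exact (mem_sdiff.1 (h₁X x (mem_sdiff.2 ⟨hx, hxQ⟩))).1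
  obtain ⟨t, htY, htA, htS, htr⟩ : ∃ t : Finset α, #Y ≤ #t ∧ (∀ x ∈ A', ∀ y ∈ t, G.Adj x y) ∧
      Disjoint t (S.image φ) ∧ (#Y ≤ r → t ⊆ B') := by
    by_cases hYr : #Y ≤ r
    · exact ⟨B', by rwa [hR.card_eq (hR.symm hAB')], hR.adj hAB', hB', fun _ ↦ Subset.rfl⟩
    · obtain ⟨N, hKN, hN⟩ := hR.exists_common hAB'
      refine ⟨N \ S.image φ, ?_, fun x hx y hy ↦ hN x hx y (mem_sdiff.1 hy).1, sdiff_disjoint,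
        fun h ↦ absurd h hYr⟩
      have h1 := le_card_sdiff (S.image φ) N
      have h2 : #(S.image φ) ≤ m := card_image_le.trans hSm
      omega
  have ht : Disjoint t ((S ∪ X).image φ₁) := by
    rw [disjoint_left]
    intro y hy hyi
    obtain ⟨w, hw, rfl⟩ := mem_image.1 hyi
    rcases mem_union.1 hw with hw | hw
    · rw [h₁S w hw] at hy
      exact disjoint_left.1 htS hy (mem_image_of_mem φ hw)
    · exact (htA _ (h₁A w hw) _ hy).ne rfl
  obtain ⟨ψ, hψ, hψinj, hψY⟩ := exists_injOn_extension h₁inj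
    (disjoint_union_right.2 ⟨hYS, hXY.symm⟩) htY ht
  have hψX : ∀ x ∈ X, ψ x ∈ A' := fun x hx ↦ hψ x (mem_union_right _ hx) ▸ h₁A x hx
  exact ⟨ψ, fun w hw ↦ (hψ w (mem_union_left _ hw)).trans (h₁S w hw), hψinj,
    fun x hx y hy ↦ htA _ (hψX x hx) _ (hψY y hy), A', B', hAB', hψX,
    fun h y hy ↦ htr h (hψY y hy)⟩


omit [DecidableEq W] [DecidableEq α] in
/-- In a tree, every vertex has at most one neighbour closer to a given root. -/
theorem SimpleGraph.IsTree.eq_of_adj_of_dist_lt {T : SimpleGraph V} (hT : T.IsTree) {o x y z : V}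
    (hy : T.Adj x y) (hz : T.Adj x z) (hyd : T.dist o y < T.dist o x)
    (hzd : T.dist o z < T.dist o x) : y = z := by
  have key : ∀ {y}, T.Adj x y → T.dist o y < T.dist o x →
      ∃ p : T.Walk o x, p.IsPath ∧ p.penultimate = y := by
    intro y hy hyd
    obtain ⟨p, hp⟩ := hT.connected.exists_walk_length_eq_dist o y
    refine ⟨p.concat hy.symm, SimpleGraph.Walk.isPath_of_length_eq_dist _ ?_, by simp⟩
    have := hT.dist_eq_dist_add_one_of_adj o hy
    rw [SimpleGraph.Walk.length_concat, hp]
    omega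
  obtain ⟨p, hp, rfl⟩ := key hy hyd
  obtain ⟨q, hq, rfl⟩ := key hz hzd
  rw [(hT.existsUnique_path o x).unique hp hq]

omit [DecidableEq W] in
open Classical in
/-- The vertices of the base graph of a degenerate blow-up can be ordered so that
every vertex has few neighbours, counted with multiplicity, among its predecessors. -/
theorem Degenerate.exists_injective_rank [Fintype W] [Finite V] {F : SimpleGraph W}
    {T : SimpleGraph V} {r : ℕ} (hF : Degenerate r F) {π : W → V} (hπ : Function.Surjective π)
    (hFT : ∀ w w', F.Adj w w' ↔ T.Adj (π w) (π w')) :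
    ∃ f : V → ℕ, Function.Injective f ∧ ∀ u, #{w | T.Adj u (π w) ∧ f (π w) < f u} ≤ r := by
  have := Fintype.ofFinite V
  suffices h : ∀ S : Finset V, ∃ f : V → ℕ, Set.InjOn f S ∧
      ∀ u ∈ S, #{w | T.Adj u (π w) ∧ π w ∈ S ∧ f (π w) < f u} ≤ r by
    obtain ⟨f, hf, hfr⟩ := h univ
    exact ⟨f, fun x y h ↦ hf (by simp) (by simp) h, fun u ↦ by simpa using hfr u (mem_univ u)⟩
  intro S
  induction S using Finset.strongInduction with
  | H S ih =>
    rcases S.eq_empty_or_nonempty with rfl | ⟨v, hv⟩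
    · exact ⟨fun _ ↦ 0, by simp, by simp⟩
    obtain ⟨x, rfl⟩ := hπ v
    obtain ⟨w, hwS, hw⟩ := hF ((⊤ : F.Subgraph).induce {w | π w ∈ S}) ⟨x, hv⟩
    replace hwS : π w ∈ S := hwS
    obtain ⟨f, hf, hfr⟩ := ih _ (erase_ssubset hwS)
    have hlt : ∀ y ∈ S, f y < S.sup f + 1 := fun y hy ↦ Nat.lt_succ_of_le (le_sup hy)
    refine ⟨fun y ↦ if y = π w then S.sup f + 1 else f y, ?_, ?_⟩
    · intro y hy z hz hyz
      have h1 := hlt y hy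
      have h2 := hlt z hz
      by_cases hy' : y = π w <;> by_cases hz' : z = π w <;>
        simp only [hy', hz', if_true, if_false] at hyz
      · rw [hy', hz']
      · omega
      · omega
      · exact hf (by simpa [hy'] using hy) (by simpa [hz'] using hz) hyz
    · intro u hu
      by_cases huw : u = π w
      · refine le_trans ?_ hw
        rw [← Set.ncard_coe_finset]
        refine Set.ncard_le_ncard ?_ (Set.toFinite _)
        intro y hy
        simp only [coe_filter, mem_univ, true_and, Set.mem_ofPred_eq] at hy
        simp only [SimpleGraph.Subgraph.mem_neighborSet, SimpleGraph.Subgraph.induce_adj,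
          Set.mem_ofPred_eq, SimpleGraph.Subgraph.top_adj, hFT]
        exact ⟨hwS, hy.2.1, huw ▸ hy.1⟩
      · refine le_trans (card_le_card ?_) (hfr u (mem_erase.2 ⟨huw, hu⟩))
        intro y hy
        have h1 := hlt u hu
        simp only [mem_filter, mem_univ, true_and, huw, if_false, mem_erase] at hy ⊢
        obtain ⟨h2, h3, h4⟩ := hy
        by_cases hyw : π y = π w
        · rw [if_pos hyw] at h4
          omega
        · rw [if_neg hyw] at h4
          exact ⟨h2, ⟨hyw, h3⟩, h4⟩

open Classical in
/-- A graph with a sufficiently rich family contains every degenerate blow-up of a tree. -/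
theorem IsRichFamily.containsCopy [Fintype W] {F : SimpleGraph W} {T : SimpleGraph V}
    {G : SimpleGraph α} {r : ℕ} {R : Finset α → Finset α → Prop}
    (hR : IsRichFamily G r (Fintype.card W) (2 * Fintype.card W) R) (hr : 1 ≤ r)
    (hF : Degenerate r F) (hT : T.IsTree) {π : W → V} (hπ : Function.Surjective π)
    (hFT : ∀ w w', F.Adj w w' ↔ T.Adj (π w) (π w')) : ContainsCopy F G := by
  have : Finite V := Finite.of_surjective π hπ
  have := Fintype.ofFinite V
  obtain ⟨f, hf, hfr⟩ := hF.exists_injective_rank hπ hFT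
  obtain ⟨o⟩ := hT.connected.nonempty
  set d : V → ℕ := T.dist o with hd
  set D : V → V → Prop := fun u v ↦ T.Adj u v ∧ f v < f u with hD
  let I : V → Finset W := fun u ↦ {w | π w = u}
  let O : V → Finset W := fun u ↦ {w | D u (π w)}
  have hI : ∀ u w, w ∈ I u ↔ π w = u := by simp [I]
  have hO : ∀ u w, w ∈ O u ↔ D u (π w) := by simp [O]
  have hOr : ∀ u, #(O u) ≤ r := hfr
  have hsubO : ∀ {u v}, D u v → I v ⊆ O u := fun {u v} h w hw ↦ by rw [hO, (hI _ _).1 hw]; exact h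
  have hDne : ∀ {u v}, D u v → d u ≠ d v := fun h ↦ hT.dist_ne_of_adj o h.1
  have hdisj : ∀ u, Disjoint (I u) (O u) := fun u ↦ by
    rw [disjoint_left]
    intro w hw hw'
    rw [hI] at hw
    rw [hO, hw] at hw'
    exact hw'.1.ne rfl
  let placed : Finset V → V → Prop := fun P v ↦ ∃ u ∈ P, v = u ∨ D u v
  obtain ⟨A₀, B₀, hAB₀⟩ := hR.nonempty
  suffices h : ∀ P : Finset V, (∀ x ∈ P, ∀ y, T.Adj x y → d y < d x → y ∈ P) →
      ∃ φ : W → α, Set.InjOn φ {w | placed P (π w)} ∧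
        (∀ u ∈ P, ∀ x ∈ I u, ∀ y ∈ O u, G.Adj (φ x) (φ y)) ∧
        ∀ v, placed P v → #(I v) ≤ r → ∃ A B, R A B ∧ ∀ w ∈ I v, φ w ∈ A by
    obtain ⟨φ, hφ, hadj, -⟩ := h univ (by simp)
    refine ⟨φ, fun x y hxy ↦ hφ ⟨π x, by simp⟩ ⟨π y, by simp⟩ hxy, fun a b hab ↦ ?_⟩
    rw [hFT] at hab
    rcases lt_or_gt_of_ne (hf.ne hab.ne) with h | h
    · exact (hadj (π b) (mem_univ _) b (by simp [hI]) a ((hO _ _).2 ⟨hab.symm, h⟩)).symm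
    · exact hadj (π a) (mem_univ _) a (by simp [hI]) b ((hO _ _).2 ⟨hab, h⟩)
  intro P
  induction P using Finset.induction_on_max_value d with
  | empty =>
    intro _
    have : A₀.Nonempty := by
      rw [← card_pos, hR.card_eq hAB₀]
      exact hr
    exact ⟨fun _ ↦ this.choose, by simp [placed], by simp, by simp [placed]⟩
  | insert u P huP hmax ih =>
    intro hclosed
    obtain ⟨φ, hφ, hadj, hgood⟩ := ih fun x hx y hxy hyx ↦ by
      rcases mem_insert.1 (hclosed x (mem_insert_of_mem hx) y hxy hyx) with rfl | h
      · exact absurd (hmax x hx) (not_le.2 hyx)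
      · exact h
    let S : Finset W := {w | placed P (π w)}
    have hS : ∀ w, w ∈ S ↔ placed P (π w) := by simp [S]
    have hφS : Set.InjOn φ S := by simpa [S] using hφ
    have hchild : ∀ v, D u v → placed P v → d v < d u := by
      rintro v hv ⟨p, hp, hpv⟩
      by_contra hlt
      have huv : d u < d v := lt_of_le_of_ne (not_lt.1 hlt) (hDne hv)
      rcases hpv with rfl | hpv
      · exact absurd (hmax v hp) (not_le.2 huv)
      · have := hT.eq_of_adj_of_dist_lt hpv.1.symm hv.1.symm ((hmax p hp).trans_lt huv) huv
        exact huP (this ▸ hp)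
    have hSm : #S ≤ Fintype.card W := card_le_univ S
    have hK : ∀ Y : Finset W, Fintype.card W + #Y ≤ 2 * Fintype.card W := fun Y ↦ by
      have := card_le_univ Y
      omega
    obtain ⟨ψ, hψS, hψinj, hψadj, A, B, hAB, hψO, hψI⟩ : ∃ ψ : W → α, (∀ w ∈ S, ψ w = φ w) ∧
        Set.InjOn ψ (S ∪ O u ∪ I u : Finset W) ∧ (∀ x ∈ O u, ∀ y ∈ I u, G.Adj (ψ x) (ψ y)) ∧
        ∃ A B, R A B ∧ (∀ x ∈ O u, ψ x ∈ A) ∧ (#(I u) ≤ r → ∀ y ∈ I u, ψ y ∈ B) := by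
      by_cases hu : placed P u
      · obtain ⟨p, hp, hpu⟩ := id hu
        replace hpu : D p u := hpu.resolve_left (by rintro rfl; exact huP hp)
        have hIr : #(I u) ≤ r := (card_le_card (hsubO hpu)).trans (hOr p)
        obtain ⟨A, B, hAB, hA⟩ := hgood u hu hIr
        have hIS : I u ⊆ S := fun w hw ↦ by rw [hS, (hI _ _).1 hw]; exact hu
        have hOS : Disjoint (O u) S := by
          rw [disjoint_left]
          intro w hw hwS
          rw [hO] at hw
          rw [hS] at hwS
          have hpw := hT.eq_of_adj_of_dist_lt hpu.1.symm hw.1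
            (lt_of_le_of_ne (hmax p hp) (hDne hpu)) (hchild _ hw hwS)
          exact lt_asymm hpu.2 (hpw ▸ hw.2)
        obtain ⟨ψ, h1, h2, h3, A', B', h4, h5, h6⟩ := hR.exists_extension hφS hSm (hK (O u)) hIr
          Subset.rfl hIS inter_subset_left hOS (hdisj u) hAB (image_subset_iff.2 hA)
        exact ⟨ψ, h1, by rwa [union_right_comm], fun x hx y hy ↦ (h3 y hy x hx).symm, B', A',
          hR.symm h4, h6 (hOr u), fun _ ↦ h5⟩
      · have hIS : Disjoint (I u) S := by
          rw [disjoint_left]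
          intro w hw hwS
          rw [hS, (hI _ _).1 hw] at hwS
          exact hu hwS
        by_cases hp : ∃ p, D u p ∧ d p < d u
        · obtain ⟨p, hup, hpd⟩ := hp
          have hpP : p ∈ P :=
            (mem_insert.1 (hclosed u (mem_insert_self _ _) p hup.1 hpd)).resolve_left hup.1.ne'
          have hpp : placed P p := ⟨p, hpP, Or.inl rfl⟩
          obtain ⟨A, B, hAB, hA⟩ := hgood p hpp ((card_le_card (hsubO hup)).trans (hOr u))
          refine hR.exists_extension hφS hSm (hK (I u)) (hOr u) (hsubO hup) ?_ ?_ hIS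
            (hdisj u).symm hAB (image_subset_iff.2 hA)
          · intro w hw
            rw [hS, (hI _ _).1 hw]
            exact hpp
          · intro w hw
            rw [mem_inter, hO, hS] at hw
            rw [hI]
            exact hT.eq_of_adj_of_dist_lt hw.1.1 hup.1 (hchild _ hw.1 hw.2) hpd
        · refine hR.exists_extension (Q := ∅) hφS hSm (hK (I u)) (hOr u) (empty_subset _)
            (empty_subset _) ?_ hIS (hdisj u).symm hAB₀ (by simp)
          intro w hw
          rw [mem_inter, hO, hS] at hw
          exact absurd ⟨_, hw.1, hchild _ hw.1 hw.2⟩ hp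
    have hplaced : ∀ v, placed (insert u P) v ↔ placed P v ∨ D u v ∨ v = u := by
      intro v
      simp only [placed, mem_insert, exists_eq_or_imp]
      rw [or_comm, or_comm (a := v = u)]
    refine ⟨ψ, ?_, ?_, ?_⟩
    · refine hψinj.mono fun w hw ↦ ?_
      rw [mem_coe, mem_union, mem_union, hS, hO, hI, or_assoc]
      exact (hplaced _).1 hw
    · intro v hv x hx y hy
      rcases mem_insert.1 hv with rfl | hv
      · exact (hψadj y hy x hx).symm
      · rw [hψS x ((hS x).2 ⟨v, hv, Or.inl ((hI _ _).1 hx)⟩),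
          hψS y ((hS y).2 ⟨v, hv, Or.inr ((hO _ _).1 hy)⟩)]
        exact hadj v hv x hx y hy
    · intro v hv hvr
      rcases (hplaced v).1 hv with hv | hv | rfl
      · obtain ⟨A', B', hAB', hA'⟩ := hgood v hv hvr
        refine ⟨A', B', hAB', fun w hw ↦ ?_⟩
        rw [hψS w (by rw [hS, (hI _ _).1 hw]; exact hv)]
        exact hA' w hw
      · exact ⟨A, B, hAB, fun w hw ↦ hψO w (hsubO hv hw)⟩
      · exact ⟨B, A, hR.symm hAB, hψI hvr⟩

end Embedding

section Counting

open Finset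

variable {α : Type*} [DecidableEq α]

/-- Among the `r`-subsets of `Y` containing `a`, few meet a given small set outside of `a`. -/
theorem mul_card_filter_not_disjoint_sdiff_le (Y a Z : Finset α) (r : ℕ) :
    (#Y - #a) * #{A ∈ powersetCard r Y | a ⊆ A ∧ ¬Disjoint (A \ a) Z} ≤
      #Z * r * #{A ∈ powersetCard r Y | a ⊆ A} := by
  have hz : ∀ z ∈ Z \ a, (#Y - #a) * #{A ∈ powersetCard r Y | insert z a ⊆ A} ≤
      r * #{A ∈ powersetCard r Y | a ⊆ A} := by
    intro z hz
    have hza : z ∉ a := (mem_sdiff.1 hz).2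
    rcases eq_empty_or_nonempty {A ∈ powersetCard r Y | insert z a ⊆ A} with h | ⟨A, hA⟩
    · simp [h]
    rw [mem_filter, mem_powersetCard] at hA
    obtain ⟨⟨hAY, hAr⟩, hzA⟩ := hA
    have hcard : #(insert z a) = #a + 1 := card_insert_of_notMem hza
    have h1 : #a + 1 ≤ r := by rw [← hcard, ← hAr]; exact card_le_card hzA
    have h2 : #a + 1 ≤ #Y := by rw [← hcard]; exact card_le_card (hzA.trans hAY)
    rw [card_filter_powersetCard_subset (insert z a) Y r (hzA.trans hAY) (by omega),
      card_filter_powersetCard_subset a Y r ((subset_insert z a).trans (hzA.trans hAY)) (by omega),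
      hcard]
    obtain ⟨p, hp⟩ := Nat.exists_eq_add_of_le h1
    obtain ⟨q, hq⟩ := Nat.exists_eq_add_of_le h2
    have e1 : #Y - #a = q + 1 := by omega
    have e2 : #Y - (#a + 1) = q := by omega
    have e3 : r - #a = p + 1 := by omega
    have e4 : r - (#a + 1) = p := by omega
    rw [e1, e2, e3, e4, Nat.add_one_mul_choose_eq, mul_comm]
    exact Nat.mul_le_mul_right _ (by omega)
  have hsub : ({A ∈ powersetCard r Y | a ⊆ A ∧ ¬Disjoint (A \ a) Z} : Finset (Finset α)) ⊆
      (Z \ a).biUnion fun z ↦ {A ∈ powersetCard r Y | insert z a ⊆ A} := by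
    intro A hA
    rw [mem_filter, not_disjoint_iff] at hA
    obtain ⟨hA, haA, z, hzA, hzZ⟩ := hA
    rw [mem_sdiff] at hzA
    exact mem_biUnion.2 ⟨z, mem_sdiff.2 ⟨hzZ, hzA.2⟩,
      mem_filter.2 ⟨hA, insert_subset hzA.1 haA⟩⟩
  calc _ ≤ (#Y - #a) * ∑ z ∈ Z \ a, #{A ∈ powersetCard r Y | insert z a ⊆ A} :=
        Nat.mul_le_mul_left _ ((card_le_card hsub).trans card_biUnion_le)
    _ = ∑ z ∈ Z \ a, (#Y - #a) * #{A ∈ powersetCard r Y | insert z a ⊆ A} := mul_sum _ _ _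
    _ ≤ #(Z \ a) * (r * #{A ∈ powersetCard r Y | a ⊆ A}) := by
        simpa using sum_le_card_nsmul _ _ _ hz
    _ ≤ _ := by
        rw [mul_assoc]
        exact Nat.mul_le_mul_right _ (card_le_card sdiff_subset)

/-- If, for every `a`, few pairs `(A, B)` in `E₀` with `a ⊆ A` meet a small set `Z` outside of `a`,
then some nonempty symmetric subfamily of `E₀` has the extension property of a rich family. -/
theorem exists_subset_forall_exists_disjoint [Fintype α] {r m k c : ℕ}
    {E E₀ : Finset (Finset α × Finset α)} (hE : ∀ e ∈ E, #e.1 = r)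
    (hsymm : ∀ e ∈ E₀, e.swap ∈ E₀)
    (hbad : ∀ a Z : Finset α, #Z ≤ m →
      k * #{e ∈ E₀ | a ⊆ e.1 ∧ ¬(Disjoint (e.1 \ a) Z ∧ Disjoint e.2 Z)} ≤
        c * #{e ∈ E | a ⊆ e.1})
    (hlarge : 2 * c * (2 ^ r * #E) < k * #E₀) :
    ∃ E₁ ⊆ E₀, E₁.Nonempty ∧ (∀ e ∈ E₁, e.swap ∈ E₁) ∧
      ∀ e ∈ E₁, ∀ a ⊆ e.1, ∀ Z : Finset α, #Z ≤ m →
        ∃ e' ∈ E₁, a ⊆ e'.1 ∧ Disjoint (e'.1 \ a) Z ∧ Disjoint e'.2 Z := by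
  let del : Finset (Finset α) → Finset (Finset α × Finset α) := fun 𝒦 ↦
    {e ∈ E₀ | ∃ a ∈ 𝒦, a ⊆ e.1 ∨ a ⊆ e.2}
  have hdel : ∀ 𝒦 e, e ∈ del 𝒦 ↔ e ∈ E₀ ∧ ∃ a ∈ 𝒦, a ⊆ e.1 ∨ a ⊆ e.2 := by simp [del]
  obtain ⟨𝒦, h𝒦, hmax⟩ := exists_max_image
    ({𝒦 | k * #(del 𝒦) ≤ ∑ a ∈ 𝒦, 2 * c * #{e ∈ E | a ⊆ e.1}} : Finset (Finset (Finset α)))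
    card ⟨∅, by simp [del]⟩
  simp only [mem_filter, mem_univ, true_and] at h𝒦 hmax
  have htotal : ∑ a : Finset α, #{e ∈ E | a ⊆ e.1} = 2 ^ r * #E := by
    calc ∑ a : Finset α, #{e ∈ E | a ⊆ e.1} = ∑ e ∈ E, #{a : Finset α | a ⊆ e.1} := by
          simp only [card_filter]
          exact sum_comm
      _ = ∑ e ∈ E, 2 ^ r := sum_congr rfl fun e he ↦ by
          rw [← hE e he, ← card_powerset]
          congr 1
          ext
          simp
      _ = _ := by simp [mul_comm]
  have hlt : #(del 𝒦) < #E₀ := by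
    refine lt_of_mul_lt_mul_left (a := k) (h𝒦.trans_lt (lt_of_le_of_lt ?_ hlarge)) (Nat.zero_le _)
    rw [← mul_sum, ← htotal]
    exact Nat.mul_le_mul_left _ (sum_le_sum_of_subset (subset_univ _))
  refine ⟨E₀ \ del 𝒦, sdiff_subset, ?_, ?_, ?_⟩
  · rw [← card_pos]
    have := le_card_sdiff (del 𝒦) E₀
    omega
  · intro e he
    rw [mem_sdiff, hdel] at he ⊢
    refine ⟨hsymm e he.1, fun h ↦ he.2 ⟨he.1, ?_⟩⟩
    obtain ⟨-, a, ha, h⟩ := h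
    exact ⟨a, ha, h.symm⟩
  · intro e he a hae Z hZ
    by_contra! hno
    have ha : a ∉ 𝒦 := fun ha ↦
      (mem_sdiff.1 he).2 ((hdel _ _).2 ⟨(mem_sdiff.1 he).1, a, ha, .inl hae⟩)
    let bad : Finset (Finset α × Finset α) :=
      {e ∈ E₀ | a ⊆ e.1 ∧ ¬(Disjoint (e.1 \ a) Z ∧ Disjoint e.2 Z)}
    have hmem : ∀ x ∈ E₀, x ∉ del 𝒦 → a ⊆ x.1 → x ∈ bad := fun x hx hxd hax ↦
      mem_filter.2 ⟨hx, hax, fun h ↦ hno x (mem_sdiff.2 ⟨hx, hxd⟩) hax h.1 h.2⟩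
    have hsub : del (insert a 𝒦) ⊆ del 𝒦 ∪ (bad ∪ bad.image Prod.swap) := by
      intro x hx
      by_cases hxd : x ∈ del 𝒦
      · exact mem_union_left _ hxd
      refine mem_union_right _ ?_
      obtain ⟨hx₀, b, hb, hbx⟩ := (hdel _ _).1 hx
      rcases mem_insert.1 hb with rfl | hb
      · rcases hbx with hbx | hbx
        · exact mem_union_left _ (hmem x hx₀ hxd hbx)
        · refine mem_union_right _ (mem_image.2 ⟨x.swap, hmem _ (hsymm x hx₀) ?_ hbx, x.swap_swap⟩)
          rw [hdel]
          rintro ⟨-, b', hb', h⟩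
          exact hxd ((hdel _ _).2 ⟨hx₀, b', hb', h.symm⟩)
      · exact absurd ((hdel _ _).2 ⟨hx₀, b, hb, hbx⟩) hxd
    have hcard : #(del (insert a 𝒦)) ≤ #(del 𝒦) + 2 * #bad := by
      have h1 := card_le_card hsub
      have h2 := card_union_le (del 𝒦) (bad ∪ bad.image Prod.swap)
      have h3 := card_union_le bad (bad.image Prod.swap)
      have h4 : #(bad.image Prod.swap) ≤ #bad := card_image_le
      omega
    have := hmax (insert a 𝒦) (by
      rw [sum_insert ha]
      have h1 := Nat.mul_le_mul_left k hcard
      have h2 := hbad a Z hZ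
      change k * #bad ≤ _ at h2
      linarith)
    rw [card_insert_of_notMem ha] at this
    omega

end Counting

section Bipartite

open Finset

variable {α : Type*} [Fintype α] [DecidableEq α]

omit [DecidableEq α] in
open Classical in
/-- The common neighbourhood of a finite set of vertices. -/
noncomputable def commonNeighborFinset (G : SimpleGraph α) (A : Finset α) : Finset α :=
  {v | ∀ x ∈ A, G.Adj x v}

omit [DecidableEq α] in
open Classical in
/-- The ordered pairs of completely joined `r`-sets of vertices. -/
noncomputable def completePairs (G : SimpleGraph α) (r : ℕ) : Finset (Finset α × Finset α) :=
  {e | #e.1 = r ∧ e.2 ∈ powersetCard r (commonNeighborFinset G e.1)}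

variable {G : SimpleGraph α} {r : ℕ}

theorem mem_commonNeighborFinset {A : Finset α} {v : α} :
    v ∈ commonNeighborFinset G A ↔ ∀ x ∈ A, G.Adj x v := by
  simp [commonNeighborFinset]

theorem mem_completePairs {e : Finset α × Finset α} :
    e ∈ completePairs G r ↔ #e.1 = r ∧ #e.2 = r ∧ ∀ x ∈ e.1, ∀ y ∈ e.2, G.Adj x y := by
  simp only [completePairs, mem_filter, mem_univ, true_and, mem_powersetCard, subset_iff,
    mem_commonNeighborFinset]
  grind

theorem swap_mem_completePairs {e : Finset α × Finset α} (he : e ∈ completePairs G r) :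
    e.swap ∈ completePairs G r := by
  rw [mem_completePairs] at he ⊢
  exact ⟨he.2.1, he.1, fun x hx y hy ↦ (he.2.2 y hy x hx).symm⟩

theorem card_filter_completePairs (p : Finset α → Prop) (q : Finset α → Finset α → Prop)
    [DecidablePred p] [DecidableRel q] :
    #{e ∈ completePairs G r | p e.1 ∧ q e.1 e.2} = ∑ A ∈ powersetCard r univ with p A,
      #{B ∈ powersetCard r (commonNeighborFinset G A) | q A B} := by
  rw [← card_sigma]
  refine card_bij' (fun e _ ↦ ⟨e.1, e.2⟩) (fun e _ ↦ (e.1, e.2)) ?_ ?_ (by simp) (by simp)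
  · intro e he
    simp only [completePairs, mem_filter, mem_univ, true_and, mem_sigma, mem_powersetCard] at he ⊢
    exact ⟨⟨⟨subset_univ _, he.1.1⟩, he.2.1⟩, he.1.2, he.2.2⟩
  · intro e he
    simp only [completePairs, mem_filter, mem_univ, true_and, mem_sigma, mem_powersetCard] at he ⊢
    exact ⟨⟨he.1.1.2, he.2.1⟩, he.1.2, he.2.2⟩

theorem card_filter_swap_completePairs (p : Finset α → Finset α → Prop) [DecidableRel p] :
    #{e ∈ completePairs G r | p e.2 e.1} = #{e ∈ completePairs G r | p e.1 e.2} := by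
  refine card_bij' (fun e _ ↦ e.swap) (fun e _ ↦ e.swap) ?_ ?_ (by simp) (by simp) <;>
  · intro e he
    rw [mem_filter] at he ⊢
    exact ⟨swap_mem_completePairs he.1, he.2⟩

theorem mul_card_filter_completePairs_le (p : Finset α → Prop) [DecidablePred p]
    (a Z : Finset α) (K : ℕ) :
    (K - #a) * #{e ∈ completePairs G r | (p e.1 ∧ K ≤ #(commonNeighborFinset G e.1)) ∧
        a ⊆ e.2 ∧ ¬Disjoint (e.2 \ a) Z} ≤
      #Z * r * #{e ∈ completePairs G r | p e.1 ∧ a ⊆ e.2} := by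
  rw [card_filter_completePairs (fun A ↦ p A ∧ K ≤ #(commonNeighborFinset G A))
    (fun _ B ↦ a ⊆ B ∧ ¬Disjoint (B \ a) Z), card_filter_completePairs p (fun _ B ↦ a ⊆ B),
    mul_sum, mul_sum]
  refine (sum_le_sum fun A hA ↦ ?_).trans (sum_le_sum_of_subset (f := fun A ↦
    #Z * r * #{B ∈ powersetCard r (commonNeighborFinset G A) | a ⊆ B})
    (monotone_filter_right _ fun A _ hA ↦ hA.1))
  exact (Nat.mul_le_mul_right _ (Nat.sub_le_sub_right (mem_filter.1 hA).2.2 _)).trans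
    (mul_card_filter_not_disjoint_sdiff_le _ a Z r)

theorem card_filter_card_commonNeighborFinset_lt_le (K : ℕ) :
    #{e ∈ completePairs G r | #(commonNeighborFinset G e.1) < K} ≤ Fintype.card α ^ r * 2 ^ K := by
  have h := card_filter_completePairs (G := G) (r := r)
    (fun A ↦ #(commonNeighborFinset G A) < K) (fun _ _ ↦ True)
  simp only [and_true, filter_true] at h
  rw [h]
  calc _ ≤ ∑ A ∈ powersetCard r (univ : Finset α) with #(commonNeighborFinset G A) < K, 2 ^ K := by
        refine sum_le_sum fun A hA ↦ ?_
        rw [card_powersetCard]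
        exact (Nat.choose_le_two_pow _ _).trans
          (Nat.pow_le_pow_right two_pos (mem_filter.1 hA).2.le)
    _ ≤ _ := by
        rw [sum_const, smul_eq_mul]
        refine Nat.mul_le_mul_right _ ((card_filter_le _ _).trans ?_)
        rw [card_powersetCard]
        exact Nat.choose_le_pow _ _

theorem sum_choose_degree_le [DecidableRel G.Adj] (hr : 1 ≤ r) : ∑ v, (G.degree v).choose r ≤
    #(completePairs G r) + r * Fintype.card α ^ r := by
  have h := card_filter_completePairs (G := G) (r := r) (fun _ ↦ True) (fun _ _ ↦ True)
  simp only [and_true, filter_true, card_powersetCard] at h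
  have hchoose : ∀ n, n ≤ n.choose r + r := by
    intro n
    induction n with
    | zero => exact Nat.zero_le _
    | succ n ih =>
      rcases Nat.lt_or_ge n r with h | h
      · omega
      · obtain ⟨k, rfl⟩ := Nat.exists_eq_add_of_le' hr
        have := Nat.choose_pos (show k ≤ n by omega)
        rw [Nat.choose_succ_succ']
        omega
  calc ∑ v, (G.degree v).choose r
      = ∑ v, #{A ∈ powersetCard r (univ : Finset α) | v ∈ commonNeighborFinset G A} := by
        refine sum_congr rfl fun v _ ↦ ?_
        rw [← SimpleGraph.card_neighborFinset_eq_degree, ← card_powersetCard]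
        congr 1
        ext A
        simp only [mem_powersetCard, mem_filter, mem_univ, implies_true, true_and,
          mem_commonNeighborFinset, subset_iff, SimpleGraph.mem_neighborFinset, G.adj_comm v]
        exact and_comm
    _ = ∑ A ∈ powersetCard r (univ : Finset α), #(commonNeighborFinset G A) := by
        simp only [card_filter]
        rw [sum_comm]
        simp
    _ ≤ ∑ A ∈ powersetCard r (univ : Finset α), ((#(commonNeighborFinset G A)).choose r + r) :=
        sum_le_sum fun A _ ↦ hchoose _
    _ ≤ _ := by
        rw [sum_add_distrib, h, sum_const, card_powersetCard, smul_eq_mul, mul_comm r]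
        exact Nat.add_le_add_left (Nat.mul_le_mul_right _ (Nat.choose_le_pow _ _)) _

/-- A graph with many stars with `r` leaves has a rich family. -/
theorem exists_isRichFamily [DecidableRel G.Adj] {m K : ℕ} (hr : 1 ≤ r)
    (hK : 8 * (m * r) * 2 ^ r + r < K)
    (hG : (4 * 2 ^ K + r) * Fintype.card α ^ r < ∑ v, (G.degree v).choose r) :
    ∃ R, IsRichFamily G r m K R := by
  let E := completePairs G r
  let E₀ : Finset (Finset α × Finset α) := {e ∈ E | K ≤ #(commonNeighborFinset G e.1) ∧
    K ≤ #(commonNeighborFinset G e.2)}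
  have hE : 4 * (Fintype.card α ^ r * 2 ^ K) < #E := by
    have := sum_choose_degree_le (G := G) hr
    change _ ≤ #E + _ at this
    linarith
  have hE₀ : #E ≤ 2 * #E₀ := by
    have hsub : E ⊆ E₀ ∪ (({e ∈ E | #(commonNeighborFinset G e.1) < K} : Finset _) ∪
        {e ∈ E | #(commonNeighborFinset G e.2) < K}) := by
      intro e he
      simp only [E₀, mem_union, mem_filter, he, true_and]
      omega
    have h1 := (card_le_card hsub).trans
      ((card_union_le _ _).trans (Nat.add_le_add_left (card_union_le _ _) _))
    have h2 := card_filter_card_commonNeighborFinset_lt_le (G := G) (r := r) K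
    have h3 := card_filter_swap_completePairs (G := G) (r := r)
      fun A _ ↦ #(commonNeighborFinset G A) < K
    change #{e ∈ E | _} ≤ _ at h2
    change #{e ∈ E | _} = #{e ∈ E | _} at h3
    omega
  obtain ⟨E₁, hE₁, ⟨e₁, he₁⟩, hsymm, hfresh⟩ := exists_subset_forall_exists_disjoint
    (E := E) (E₀ := E₀) (r := r) (m := m) (k := K - r) (c := 2 * (m * r))
    (fun e he ↦ (mem_completePairs.1 he).1)
    (fun e he ↦ by
      simp only [E₀, mem_filter] at he ⊢
      exact ⟨swap_mem_completePairs he.1, he.2.2, he.2.1⟩)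
    (fun a Z hZ ↦ by
      have h1 := mul_card_filter_completePairs_le (G := G) (r := r) (a ⊆ ·) ∅ Z K
      have h2 := mul_card_filter_completePairs_le (G := G) (r := r) (fun _ ↦ True) a Z K
      rw [← card_filter_swap_completePairs (fun A B ↦
          (True ∧ K ≤ #(commonNeighborFinset G A)) ∧ a ⊆ B ∧ ¬Disjoint (B \ a) Z),
        ← card_filter_swap_completePairs (fun _ B ↦ True ∧ a ⊆ B)] at h2
      simp only [card_empty, Nat.sub_zero, empty_subset, true_and, and_true, sdiff_empty] at h1 h2
      rcases Nat.lt_or_ge r #a with har | har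
      · have hempty : ∀ e ∈ E₀, ¬a ⊆ e.1 := fun e he hae ↦ by
          have := card_le_card hae
          rw [(mem_completePairs.1 (mem_filter.1 he).1).1] at this
          omega
        rw [filter_false_of_mem fun e he h ↦ hempty e he h.1]
        simp
      have hsub : ({e ∈ E₀ | a ⊆ e.1 ∧ ¬(Disjoint (e.1 \ a) Z ∧ Disjoint e.2 Z)} : Finset _) ⊆
          ({e ∈ E | (a ⊆ e.1 ∧ K ≤ #(commonNeighborFinset G e.1)) ∧ ¬Disjoint e.2 Z} : Finset _) ∪
          {e ∈ E | K ≤ #(commonNeighborFinset G e.2) ∧ a ⊆ e.1 ∧ ¬Disjoint (e.1 \ a) Z} := by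
        intro e he
        simp only [E₀, mem_union, mem_filter] at he ⊢
        tauto
      have hZr := Nat.mul_le_mul_right #{e ∈ E | a ⊆ e.1} (Nat.mul_le_mul_right r hZ)
      calc _ ≤ (K - r) * _ := Nat.mul_le_mul_left _ ((card_le_card hsub).trans (card_union_le _ _))
        _ ≤ _ := by
          rw [mul_add]
          have h3 := (Nat.mul_le_mul_right _ (Nat.sub_le K r)).trans (h1.trans hZr)
          have h4 := (Nat.mul_le_mul_right _ (Nat.sub_le_sub_left har K)).trans (h2.trans hZr)
          linarith)
    (by
      obtain ⟨k, hk⟩ := Nat.exists_eq_add_of_lt hK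
      have : K - r = 8 * (m * r) * 2 ^ r + (k + 1) := by omega
      rw [this]
      have hpos : 0 < #E₀ := by omega
      have := Nat.mul_le_mul_left (2 * (2 * (m * r)) * 2 ^ r) hE₀
      have := Nat.mul_pos (Nat.succ_pos k) hpos
      nlinarith)
  have hmem : ∀ {A B}, (A, B) ∈ E₁ → #A = r ∧ (∀ x ∈ A, ∀ y ∈ B, G.Adj x y) ∧
      K ≤ #(commonNeighborFinset G A) := by
    intro A B h
    have h0 := mem_filter.1 (hE₁ h)
    have h1 := mem_completePairs.1 h0.1
    exact ⟨h1.1, h1.2.2, h0.2.1⟩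
  refine ⟨fun A B ↦ (A, B) ∈ E₁, ⟨e₁.1, e₁.2, he₁⟩, fun A B h ↦ hsymm _ h, fun A B h ↦ (hmem h).1,
    fun A B h ↦ (hmem h).2.1, fun A B h ↦ ⟨_, (hmem h).2.2, fun x hx y hy ↦
      mem_commonNeighborFinset.1 hy x hx⟩, fun A B h a ha Z hZ ↦ ?_⟩
  obtain ⟨e', he', h'⟩ := hfresh _ h a ha Z hZ
  exact ⟨e'.1, e'.2, he', h'⟩

end Bipartite

/-- A graph with many edges has many stars with `r` leaves. -/
theorem SimpleGraph.lt_sum_choose_degree {α : Type*} [Fintype α] (G : SimpleGraph α)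
    [DecidableRel G.Adj] {r : ℕ} (hr : 1 ≤ r) (L : ℕ)
    (hG : (r + r.factorial * L + 1 : ℝ) * (Fintype.card α : ℝ) ^ (2 - 1 / (r : ℝ)) <
      G.edgeFinset.card) :
    L * Fintype.card α ^ r < ∑ v, (G.degree v).choose r := by
  set n := Fintype.card α with hn
  set N : ℝ := (n : ℝ) ^ (2 - 1 / (r : ℝ)) with hN
  set C : ℝ := r + r.factorial * L + 1 with hC
  have hr' : (1 : ℝ) ≤ r := by exact_mod_cast hr
  have hfac : (0 : ℝ) ≤ r.factorial * L := by positivity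
  have hn0 : 0 < n := by
    have he : 0 < G.edgeFinset.card := by
      have : (0 : ℝ) < G.edgeFinset.card := lt_of_le_of_lt (by positivity) hG
      exact_mod_cast this
    obtain ⟨e, -⟩ := Finset.card_pos.1 he
    exact Fintype.card_pos_iff.2 ⟨e.out.1⟩
  have hn1 : (1 : ℝ) ≤ n := by exact_mod_cast hn0
  have hnN : (n : ℝ) ≤ N := by
    have h1 : 1 / (r : ℝ) ≤ 1 := by rw [div_le_one (by positivity)]; exact hr'
    calc (n : ℝ) = (n : ℝ) ^ (1 : ℝ) := (Real.rpow_one _).symm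
      _ ≤ N := Real.rpow_le_rpow_of_exponent_le hn1 (by linarith)
  have hNpow : N ^ r = (n : ℝ) ^ (r - 1) * (n : ℝ) ^ r := by
    rw [hN, ← Real.rpow_mul_natCast (by positivity), ← pow_add, ← Real.rpow_natCast]
    congr 1
    rw [Nat.cast_add, Nat.cast_sub hr]
    field_simp
    push_cast
    ring
  let x : α → ℕ := fun v ↦ G.degree v + 1 - r
  have hx : C * N ≤ ∑ v, (x v : ℝ) := by
    have h1 : ∑ v, ((G.degree v : ℝ) - r) ≤ ∑ v, (x v : ℝ) := by
      refine Finset.sum_le_sum fun v _ ↦ ?_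
      have : G.degree v ≤ x v + r := by simp only [x]; omega
      have : (G.degree v : ℝ) ≤ x v + r := by exact_mod_cast this
      linarith
    have h2 : ∑ v, (G.degree v : ℝ) = 2 * G.edgeFinset.card := by
      exact_mod_cast G.sum_degrees_eq_twice_card_edges
    rw [Finset.sum_sub_distrib, h2] at h1
    simp only [Finset.sum_const, Finset.card_univ, nsmul_eq_mul, ← hn] at h1
    have h3 : (n : ℝ) * r ≤ C * N := by
      rw [mul_comm]
      exact mul_le_mul (by linarith) hnN (by positivity) (by linarith)
    linarith
  have hpow : (C * N) ^ r / (n : ℝ) ^ (r - 1) ≤ ∑ v, (x v : ℝ) ^ r := by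
    have h := pow_sum_div_card_le_sum_pow (s := Finset.univ) (f := fun v ↦ (x v : ℝ))
      (fun _ _ ↦ Nat.cast_nonneg _) (r - 1)
    rw [Nat.sub_add_cancel hr, Finset.card_univ, ← hn] at h
    refine le_trans ?_ h
    gcongr
  have hchoose : ∑ v, (x v : ℝ) ^ r ≤ r.factorial * ∑ v, ((G.degree v).choose r : ℝ) := by
    rw [Finset.mul_sum]
    refine Finset.sum_le_sum fun v _ ↦ ?_
    have h := Nat.pow_sub_le_descFactorial (G.degree v) r
    rw [Nat.descFactorial_eq_factorial_mul_choose] at h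
    exact_mod_cast h
  have hCr : (r.factorial * L : ℝ) < C ^ r :=
    lt_of_lt_of_le (by linarith) (le_self_pow₀ (by linarith) (by omega))
  have hlt : (r.factorial : ℝ) * (L * (n : ℝ) ^ r) <
      r.factorial * ∑ v, ((G.degree v).choose r : ℝ) := by
    refine lt_of_lt_of_le ?_ (hpow.trans hchoose)
    rw [mul_pow, hNpow, mul_left_comm (C ^ r), mul_div_cancel_left₀ _ (by positivity), ← mul_assoc]
    exact mul_lt_mul_of_pos_right hCr (by positivity)
  exact_mod_cast lt_of_mul_lt_mul_left hlt (by positivity)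

/-- **Grósz–Janzer–Nagy, Theorem 5.** If `F` is `r`-degenerate and is a blow-up of a
tree, then `ex(n, F) = O(n^{2 - 1/r})`. -/
theorem degenerate_tree_blowup_turan {W : Type} [Fintype W] (F : SimpleGraph W)
    (r : ℕ) (hr : 1 ≤ r) (hdeg : Degenerate r F)
    (hblow : ∃ (V : Type) (T : SimpleGraph V), T.IsTree ∧ IsBlowupOf F T) :
    ∃ C : ℝ, ∀ (n : ℕ) (G : SimpleGraph (Fin n)) [DecidableRel G.Adj],
      ¬ ContainsCopy F G →
      (G.edgeFinset.card : ℝ) ≤ C * (n : ℝ) ^ (2 - 1 / (r : ℝ)) := by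
  obtain ⟨V, T, hT, π, hπ, hFT⟩ := hblow
  let m := Fintype.card W
  let K := 8 * (m * r) * 2 ^ r + r + 2 * m + 1
  refine ⟨r + r.factorial * (4 * 2 ^ K + r : ℕ) + 1, fun n G _ hG ↦ ?_⟩
  by_contra! hlt
  have h := G.lt_sum_choose_degree hr (4 * 2 ^ K + r) (by simpa only [Fintype.card_fin] using hlt)
  obtain ⟨R, hR⟩ := exists_isRichFamily (m := m) (K := K) hr (by omega) h
  classical
  exact hG ((hR.mono (by omega)).containsCopy hr hdeg hT hπ hFT)
end

section
/- Let r ≤ t and k be positive integers and let L be an (r,t)-blownup tree of size k. Then there exists a constant C (depending only on r, t and k) such that for all n, ex(n, L) ≤ C · n^{2 - 1/r}. -/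
/-- `Y` and `X` witness that `L` is an `(r,t)`-blownup tree of size `k`
(Definition 7 of Grósz–Janzer–Nagy).  Here `Y i` plays the role of `Y_i`
(`0 ≤ i ≤ k`), and `X i` plays the role of `X_{i+1}` (`1 ≤ i+1 ≤ k`):
the sets `Y_0, Y_1, …, Y_k` are pairwise disjoint with `|Y_0| = r` and
`|Y_1| = … = |Y_k| = t`, they cover the vertex set, `X_1 = Y_0`, each `X_i`
is an `r`-subset of some earlier `Y_j` (`j < i`), and the edges of `L` are
exactly the pairs `xy` with `x ∈ X_i`, `y ∈ Y_i` for some `1 ≤ i ≤ k`. -/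
def BlownupTreeData (r t k : ℕ) {V : Type*} (L : SimpleGraph V)
    (Y : Fin (k + 1) → Finset V) (X : Fin k → Finset V) : Prop :=
  (∀ i j : Fin (k + 1), i ≠ j → Disjoint (Y i) (Y j)) ∧
  (Y 0).card = r ∧
  (∀ i : Fin (k + 1), i ≠ 0 → (Y i).card = t) ∧
  (∀ v : V, ∃ i, v ∈ Y i) ∧
  (∀ i : Fin k, (X i).card = r) ∧
  (∀ i : Fin k, (i : ℕ) = 0 → X i = Y 0) ∧
  (∀ i : Fin k, ∃ j : Fin (k + 1), (j : ℕ) ≤ (i : ℕ) ∧ X i ⊆ Y j) ∧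
  (∀ u v : V, L.Adj u v ↔ ∃ i : Fin k, (u ∈ X i ∧ v ∈ Y i.succ) ∨ (v ∈ X i ∧ u ∈ Y i.succ))

/-- `L` is an `(r,t)`-blownup tree of size `k`. -/
def IsBlownupTree (r t k : ℕ) {V : Type*} (L : SimpleGraph V) : Prop :=
  ∃ Y X, BlownupTreeData r t k L Y X

open Finset in
/-- The number of maps into `N` that restrict along `e` to a member of `B`. -/
lemma card_filter_comp_embedding_mem_le {β : Type*} [Fintype β] [DecidableEq β] {r t : ℕ}
    (N : Finset β) (B : Finset (Fin r → β)) (e : Fin r ↪ Fin t) :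
    #{g : Fin t → β | (∀ i, g i ∈ N) ∧ g ∘ e ∈ B} ≤ #B * #N ^ (t - r) := by
  classical
  have hcard : Fintype.card {x // x ∉ Set.range e} = t - r := by
    rw [Fintype.card_subtype_compl, Fintype.card_fin]
    congr 1
    exact (Set.card_range_of_injective e.injective).trans (Fintype.card_fin r)
  have hpi : #(Fintype.piFinset fun _ : {x // x ∉ Set.range e} => N) = #N ^ (t - r) := by
    rw [Fintype.card_piFinset, prod_const, card_univ, hcard]
  rw [← hpi, ← card_product]
  refine card_le_card_of_injOn (fun g => (g ∘ e, fun x => g x)) ?_ ?_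
  · intro g hg
    simp only [coe_filter, mem_univ, true_and, Set.mem_ofPred_eq] at hg
    simp only [coe_product, Set.mem_prod, mem_coe, Fintype.mem_piFinset]
    exact ⟨hg.2, fun x => hg.1 x⟩
  · intro g _ g' _ h
    simp only [Prod.mk.injEq] at h
    funext x
    by_cases hx : x ∈ Set.range e
    · obtain ⟨y, rfl⟩ := hx
      exact congrFun h.1 y
    · exact congrFun h.2 ⟨x, hx⟩

open Finset in
/-- Supersaturation: if every `t`-subset of `N \ W` contains an injective `r`-tuple from `B`,
then `B` contains a positive proportion of the `r`-tuples in `N`, unless `N` is small. -/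
lemma card_pow_le_of_forall_subset_exists {β : Type*} [Fintype β] [DecidableEq β]
    {r t K : ℕ} (hrt : r ≤ t) (N W : Finset β) (hW : #W ≤ K) (B : Finset (Fin r → β))
    (h : ∀ T ⊆ N \ W, #T = t → ∃ b ∈ B, Function.Injective b ∧ ∀ i, b i ∈ T) :
    #N ^ r ≤ (2 * (K + t)) ^ r + 2 ^ t * t ^ r * #{b ∈ B | ∀ i, b i ∈ N} := by
  classical
  by_cases hN : #N ≤ 2 * (K + t)
  · exact (Nat.pow_le_pow_left hN r).trans (Nat.le_add_right _ _)
  push Not at hN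
  refine le_trans ?_ (Nat.le_add_left _ _)
  set B' : Finset (Fin r → β) := {b ∈ B | ∀ i, b i ∈ N} with hB'
  have hU : #N - K ≤ #(N \ W) := (Nat.sub_le_sub_left hW _).trans (le_card_sdiff W N)
  have hinj : #N ^ t ≤ 2 ^ t * Fintype.card (Fin t ↪ (N \ W : Finset β)) := by
    rw [Fintype.card_embedding_eq, Fintype.card_coe, Fintype.card_fin]
    calc #N ^ t ≤ (2 * (#(N \ W) + 1 - t)) ^ t := Nat.pow_le_pow_left (by omega) t
      _ = 2 ^ t * (#(N \ W) + 1 - t) ^ t := mul_pow _ _ _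
      _ ≤ _ := Nat.mul_le_mul_left _ (Nat.pow_sub_le_descFactorial _ _)
  have hcover : Fintype.card (Fin t ↪ (N \ W : Finset β)) ≤
      #((univ : Finset (Fin r ↪ Fin t)).biUnion fun e =>
        {g : Fin t → β | (∀ i, g i ∈ N) ∧ g ∘ e ∈ B'}) := by
    rw [← card_univ]
    refine card_le_card_of_injOn (fun g i => (g i : β)) ?_ ?_
    · intro g _
      have hgN : ∀ i, (g i : β) ∈ N := fun i => (mem_sdiff.1 (g i).2).1
      obtain ⟨b, hbB, hb, hbT⟩ := h (univ.image fun i => (g i : β))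
        (by
          intro x hx
          obtain ⟨i, -, rfl⟩ := mem_image.1 hx
          exact (g i).2)
        (by
          rw [card_image_of_injective univ
            (show Function.Injective fun i => (g i : β) from
              Subtype.val_injective.comp g.injective), card_univ, Fintype.card_fin])
      have hex : ∀ i, ∃ j, (g j : β) = b i := fun i => by simpa using hbT i
      choose e he using hex
      have hei : Function.Injective e := fun i j hij => hb (by rw [← he, ← he, hij])
      simp only [coe_biUnion, coe_univ, Set.mem_univ, Set.iUnion_true, Set.mem_iUnion, mem_coe,
        mem_filter, mem_univ, true_and]
      refine ⟨⟨e, hei⟩, hgN, ?_⟩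
      have : (fun i => (g i : β)) ∘ e = b := funext he
      simp only [Function.Embedding.coeFn_mk, this, hB', mem_filter]
      exact ⟨hbB, fun i => he i ▸ hgN _⟩
    · intro g _ g' _ hgg
      ext i
      exact congrFun hgg i
  have hcount : Fintype.card (Fin t ↪ (N \ W : Finset β)) ≤ t ^ r * (#B' * #N ^ (t - r)) := by
    refine hcover.trans ((card_biUnion_le_card_mul _ _ _ fun e _ =>
      card_filter_comp_embedding_mem_le N B' e).trans (Nat.mul_le_mul_right _ ?_))
    rw [card_univ, Fintype.card_embedding_eq, Fintype.card_fin, Fintype.card_fin]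
    exact Nat.descFactorial_le_pow _ _
  refine Nat.le_of_mul_le_mul_right ?_ (pow_pos (by omega : 0 < #N) (t - r))
  calc #N ^ r * #N ^ (t - r) = #N ^ t := by rw [← pow_add, Nat.add_sub_cancel' hrt]
    _ ≤ 2 ^ t * (t ^ r * (#B' * #N ^ (t - r))) := hinj.trans (Nat.mul_le_mul_left _ hcount)
    _ = _ := by ring

open Classical in
/-- The common neighbours of the vertices of a tuple. -/
noncomputable def commonNbrs {β : Type*} [Fintype β] (G : SimpleGraph β) {r : ℕ}
    (a : Fin r → β) : Finset β :=
  {y | ∀ i, G.Adj (a i) y}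

lemma mem_commonNbrs {β : Type*} [Fintype β] {G : SimpleGraph β} {r : ℕ}
    {a : Fin r → β} {y : β} : y ∈ commonNbrs G a ↔ ∀ i, G.Adj (a i) y := by
  simp [commonNbrs]

/-- An `r`-tuple is rich of depth `s + 1` if, outside any set of at most `K` vertices, its common
neighbourhood contains a `t`-set all of whose `r`-tuples are rich of depth `s`. -/
def IsRich {β : Type*} [Fintype β] (G : SimpleGraph β) {r : ℕ} (t K : ℕ) :
    ℕ → (Fin r → β) → Prop
  | 0, _ => True
  | s + 1, a => ∀ W : Finset β, W.card ≤ K → ∃ T ⊆ commonNbrs G a, Disjoint T W ∧ T.card = t ∧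
      ∀ b : Fin r → β, Function.Injective b → (∀ i, b i ∈ T) → IsRich G t K s b

lemma IsRich.of_succ {β : Type*} [Fintype β] {G : SimpleGraph β} {r t K s : ℕ}
    {a : Fin r → β} (h : IsRich G t K (s + 1) a) : IsRich G t K s a := by
  induction s generalizing a with
  | zero => trivial
  | succ s ih =>
    intro W hW
    obtain ⟨T, hT, hTW, hTt, hb⟩ := h W hW
    exact ⟨T, hT, hTW, hTt, fun b hbi hbT => ih (hb b hbi hbT)⟩

open Finset in
/-- Adjacency between tuples is symmetric, so it can be counted from either side. -/
lemma sum_card_filter_forall_mem_commonNbrs {β : Type*} [Fintype β] [DecidableEq β]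
    (G : SimpleGraph β) {r m : ℕ} (B : Finset (Fin m → β)) :
    ∑ a : Fin r → β, #{b ∈ B | ∀ i, b i ∈ commonNbrs G a} = ∑ b ∈ B, #(commonNbrs G b) ^ r := by
  classical
  have key := sum_card_bipartiteAbove_eq_sum_card_bipartiteBelow
    (fun (a : Fin r → β) (b : Fin m → β) => ∀ i, b i ∈ commonNbrs G a) (s := univ) (t := B)
  simp only [bipartiteAbove, bipartiteBelow] at key
  rw [key]
  refine sum_congr rfl fun b _ => ?_
  rw [← Fintype.card_piFinset_const]
  congr 1
  ext a
  simp only [mem_filter, mem_univ, true_and, Fintype.mem_piFinset, mem_commonNbrs]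
  exact ⟨fun h i j => (h j i).symm, fun h i j => (h j i).symm⟩

open Finset Classical in
/-- Tuples that are not rich contribute only `O(n ^ r)` to the number of copies of `K_{r,r}`. -/
lemma exists_forall_sum_not_isRich_le (r t K s : ℕ) (hrt : r ≤ t) :
    ∃ A : ℕ, ∀ (n : ℕ) (G : SimpleGraph (Fin n)),
      ∑ a : Fin r → Fin n with ¬ IsRich G t K s a, #(commonNbrs G a) ^ r ≤ A * n ^ r := by
  induction s with
  | zero => exact ⟨0, fun n G => by simp [IsRich]⟩
  | succ s ih =>
    obtain ⟨A, hA⟩ := ih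
    refine ⟨(2 * (K + t)) ^ r + 2 ^ t * t ^ r * A, fun n G => ?_⟩
    set B : Finset (Fin r → Fin n) := {a | ¬ IsRich G t K s a} with hB
    calc ∑ a : Fin r → Fin n with ¬ IsRich G t K (s + 1) a, #(commonNbrs G a) ^ r
        ≤ ∑ a : Fin r → Fin n with ¬ IsRich G t K (s + 1) a, ((2 * (K + t)) ^ r +
            2 ^ t * t ^ r * #{b ∈ B | ∀ i, b i ∈ commonNbrs G a}) := by
          refine sum_le_sum fun a ha => ?_
          rw [mem_filter] at ha
          have ha := ha.2
          simp only [IsRich] at ha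
          push Not at ha
          obtain ⟨W, hW, ha⟩ := ha
          refine card_pow_le_of_forall_subset_exists hrt _ W hW B fun T hT hTt => ?_
          obtain ⟨b, hb, hbT, hbr⟩ := ha T (hT.trans sdiff_subset)
            (disjoint_sdiff_self_left.mono_left hT) hTt
          exact ⟨b, by simpa [hB] using hbr, hb, hbT⟩
      _ ≤ ∑ a : Fin r → Fin n, ((2 * (K + t)) ^ r +
            2 ^ t * t ^ r * #{b ∈ B | ∀ i, b i ∈ commonNbrs G a}) :=
          sum_le_sum_of_subset (filter_subset _ _)
      _ = (2 * (K + t)) ^ r * n ^ r + 2 ^ t * t ^ r * ∑ b ∈ B, #(commonNbrs G b) ^ r := by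
          rw [sum_add_distrib, ← mul_sum, ← sum_card_filter_forall_mem_commonNbrs]
          simp [mul_comm]
      _ ≤ (2 * (K + t)) ^ r * n ^ r + 2 ^ t * t ^ r * (A * n ^ r) := by
          gcongr
          exact hA n G
      _ = _ := by ring

open Finset in
lemma sum_pow_le_card_pow_mul_sum_pow {ι : Type*} (s : Finset ι) (f : ι → ℕ) {r : ℕ}
    (hr : 1 ≤ r) : (∑ i ∈ s, f i) ^ r ≤ #s ^ (r - 1) * ∑ i ∈ s, f i ^ r := by
  obtain ⟨m, rfl⟩ := Nat.exists_eq_add_of_le' hr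
  have h := pow_sum_div_card_le_sum_pow (s := s) (f := fun i => (f i : ℝ))
    (fun i _ => (f i).cast_nonneg) m
  rcases s.eq_empty_or_nonempty with rfl | hs
  · simp
  rw [div_le_iff₀' (by have := hs.card_pos; positivity)] at h
  exact_mod_cast h

open Finset in
/-- The number of homomorphic copies of `K_{r,r}` is at least what the edge density predicts. -/
lemma two_mul_card_edgeFinset_pow_le {n r : ℕ} (hr : 1 ≤ r) (G : SimpleGraph (Fin n))
    [DecidableRel G.Adj] :
    (2 * #G.edgeFinset) ^ (r * r) ≤
      n ^ (2 * (r * (r - 1))) * ∑ a : Fin r → Fin n, #(commonNbrs G a) ^ r := by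
  classical
  have hdeg : ∑ a : Fin r → Fin n, #(commonNbrs G a) = ∑ v, G.degree v ^ r := by
    have key := sum_card_bipartiteAbove_eq_sum_card_bipartiteBelow
      (fun (a : Fin r → Fin n) (v : Fin n) => ∀ i, G.Adj (a i) v) (s := univ) (t := univ)
    simp only [bipartiteAbove, bipartiteBelow] at key
    convert key using 2 with a _ v _
    · congr 1
      ext y
      simp [mem_commonNbrs]
    · rw [← G.card_neighborFinset_eq_degree, ← Fintype.card_piFinset_const]
      congr 1
      ext a
      simp [Fintype.mem_piFinset, G.adj_comm]
  have h₁ := sum_pow_le_card_pow_mul_sum_pow univ (fun v => G.degree v) hr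
  have h₂ := sum_pow_le_card_pow_mul_sum_pow univ
    (fun a : Fin r → Fin n => #(commonNbrs G a)) hr
  rw [G.sum_degrees_eq_twice_card_edges, ← hdeg, card_univ, Fintype.card_fin] at h₁
  rw [card_univ, Fintype.card_fun, Fintype.card_fin, Fintype.card_fin] at h₂
  calc (2 * #G.edgeFinset) ^ (r * r) = ((2 * #G.edgeFinset) ^ r) ^ r := pow_mul _ _ _
    _ ≤ (n ^ (r - 1) * ∑ a : Fin r → Fin n, #(commonNbrs G a)) ^ r := Nat.pow_le_pow_left h₁ r
    _ = (n ^ (r - 1)) ^ r * (∑ a : Fin r → Fin n, #(commonNbrs G a)) ^ r := mul_pow _ _ _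
    _ ≤ (n ^ (r - 1)) ^ r * ((n ^ r) ^ (r - 1) * ∑ a : Fin r → Fin n, #(commonNbrs G a) ^ r) := by
      gcongr
    _ = _ := by rw [← mul_assoc, ← pow_mul, ← pow_mul, ← pow_add]; congr 2; ring

lemma exists_injOn_mapsTo_of_card_le {α β : Type*} [Nonempty β] {s : Finset α} {T : Finset β}
    (h : s.card ≤ T.card) : ∃ g : α → β, Set.InjOn g s ∧ ∀ v ∈ s, g v ∈ T := by
  obtain ⟨g, hg, hi⟩ := s.finite_toSet.exists_injOn_of_encard_le (t := (T : Set β))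
    (by simpa using h)
  exact ⟨g, hi, fun v hv => hg hv⟩

open Finset in
/-- A rich tuple of sufficient depth yields a copy of any blownup tree. -/
lemma containsCopy_of_isRich {β V : Type*} [Fintype β] {r t k : ℕ} (hr : 1 ≤ r) (hrt : r ≤ t)
    {L : SimpleGraph V} (hL : IsBlownupTree r t k L) {G : SimpleGraph β} {a : Fin r → β}
    (ha : IsRich G t ((k + 1) * t) (k + 1) a) : ContainsCopy L G := by
  classical
  obtain ⟨Y, X, hdisj, hY0, hYt, hcov, hX, -, hXY, hadj⟩ := hL
  have : Nonempty β := ⟨a ⟨0, hr⟩⟩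
  have hYle : ∀ j, #(Y j) ≤ t := fun j => by
    by_cases hj : j = 0
    · rw [hj, hY0]; exact hrt
    · exact (hYt j hj).le
  have main : ∀ i ≤ k, ∃ f : V → β,
      (∀ u v : V, (∃ j : Fin (k + 1), (j : ℕ) ≤ i ∧ u ∈ Y j) →
        (∃ j : Fin (k + 1), (j : ℕ) ≤ i ∧ v ∈ Y j) → f u = f v → u = v) ∧
      (∀ j : Fin k, (j : ℕ) < i → ∀ u ∈ X j, ∀ v ∈ Y j.succ, G.Adj (f u) (f v)) ∧
      (∀ j : Fin (k + 1), (j : ℕ) ≤ i → ∀ b : Fin r → β, Function.Injective b →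
        (∀ x, b x ∈ (Y j).image f) → IsRich G t ((k + 1) * t) (k - i) b) := by
    intro i
    induction i with
    | zero =>
      intro _
      obtain ⟨T, -, -, hTt, hb⟩ := ha ∅ (by simp)
      obtain ⟨f, hfi, hfT⟩ := exists_injOn_mapsTo_of_card_le ((hYle 0).trans hTt.ge)
      have h0 : ∀ j : Fin (k + 1), (j : ℕ) ≤ 0 → j = 0 := fun j hj => Fin.ext (by simpa using hj)
      refine ⟨f, ?_, fun j hj => absurd hj (Nat.not_lt_zero _), ?_⟩
      · rintro u v ⟨j, hj, hu⟩ ⟨j', hj', hv⟩ huv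
        rw [h0 j hj] at hu
        rw [h0 j' hj'] at hv
        exact hfi hu hv huv
      · intro j hj b hbi hbY
        refine hb b hbi fun x => ?_
        obtain ⟨v, hv, hvx⟩ := mem_image.1 (hbY x)
        rw [h0 j hj] at hv
        exact hvx ▸ hfT v hv
    | succ i ih =>
      intro hi
      obtain ⟨f, hfi, hfa, hfr⟩ := ih (Nat.le_of_succ_le hi)
      let p : Fin k := ⟨i, hi⟩
      obtain ⟨q, hq, hXq⟩ := hXY p
      let c : Fin r → V := fun x => (((X p).equivFinOfCardEq (hX p)).symm x : V)
      have hcX : ∀ x, c x ∈ X p := fun x => (((X p).equivFinOfCardEq (hX p)).symm x).2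
      have hci : Function.Injective c := Subtype.val_injective.comp (Equiv.injective _)
      have hcs : ∀ u ∈ X p, ∃ x, c x = u := fun u hu =>
        ⟨(X p).equivFinOfCardEq (hX p) ⟨u, hu⟩, by simp [c]⟩
      have hrich := hfr q hq (f ∘ c)
        (fun x y hxy => hci (hfi _ _ ⟨q, hq, hXq (hcX x)⟩ ⟨q, hq, hXq (hcX y)⟩ hxy))
        (fun x => mem_image_of_mem f (hXq (hcX x)))
      rw [show k - i = k - (i + 1) + 1 by omega] at hrich
      let W : Finset β := (univ.biUnion Y).image f
      have hW : #W ≤ (k + 1) * t := by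
        refine card_image_le.trans ((card_biUnion_le_card_mul _ _ t fun j _ => hYle j).trans ?_)
        simp
      obtain ⟨T, hTN, hTW, hTt, hb⟩ := hrich W hW
      have hfW : ∀ v, f v ∈ W := fun v => by
        obtain ⟨j, hj⟩ := hcov v
        exact mem_image_of_mem f (mem_biUnion.2 ⟨j, mem_univ j, hj⟩)
      obtain ⟨g, hgi, hgT⟩ := exists_injOn_mapsTo_of_card_le ((hYle p.succ).trans hTt.ge)
      have hgf : ∀ u ∈ Y p.succ, ∀ v, g u ≠ f v := fun u hu v huv =>
        disjoint_left.1 hTW (hgT u hu) (huv ▸ hfW v)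
      have hnot : ∀ j : Fin (k + 1), (j : ℕ) ≤ i → ∀ v ∈ Y j, v ∉ Y p.succ := by
        intro j hj v hv hv'
        refine disjoint_left.1 (hdisj j p.succ ?_) hv hv'
        rintro rfl
        simp [p] at hj
      have heq : ∀ j : Fin (k + 1), (j : ℕ) ≤ i + 1 → (j : ℕ) ≤ i ∨ j = p.succ := by
        intro j hj
        rcases Nat.le_succ_iff.1 hj with h | h
        · exact Or.inl h
        · exact Or.inr (Fin.ext (by simpa [p] using h))
      let f' : V → β := fun v => if v ∈ Y p.succ then g v else f v
      have hf'new : ∀ v ∈ Y p.succ, f' v = g v := fun v hv => if_pos hv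
      have hf'old : ∀ j : Fin (k + 1), (j : ℕ) ≤ i → ∀ v ∈ Y j, f' v = f v :=
        fun j hj v hv => if_neg (hnot j hj v hv)
      refine ⟨f', ?_, ?_, ?_⟩
      · rintro u v ⟨j, hj, hu⟩ ⟨j', hj', hv⟩ huv
        rcases heq j hj with hj | rfl <;> rcases heq j' hj' with hj' | rfl
        · rw [hf'old j hj u hu, hf'old j' hj' v hv] at huv
          exact hfi u v ⟨j, hj, hu⟩ ⟨j', hj', hv⟩ huv
        · rw [hf'old j hj u hu, hf'new v hv] at huv
          exact absurd huv.symm (hgf v hv u)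
        · rw [hf'new u hu, hf'old j' hj' v hv] at huv
          exact absurd huv (hgf u hu v)
        · rw [hf'new u hu, hf'new v hv] at huv
          exact hgi hu hv huv
      · intro j hj u hu v hv
        rcases Nat.lt_succ_iff_lt_or_eq.1 hj with hj | hj
        · obtain ⟨q', hq', hXq'⟩ := hXY j
          rw [hf'old q' (hq'.trans hj.le) u (hXq' hu), hf'old j.succ (by simpa using hj) v hv]
          exact hfa j hj u hu v hv
        · obtain rfl : j = p := Fin.ext hj
          rw [hf'old q hq u (hXq hu), hf'new v hv]
          obtain ⟨x, rfl⟩ := hcs u hu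
          exact mem_commonNbrs.1 (hTN (hgT v hv)) x
      · intro j hj b hbi hbY
        rcases heq j hj with hj | rfl
        · have hb' := hfr j hj b hbi fun x => by
            obtain ⟨v, hv, hvx⟩ := mem_image.1 (hbY x)
            rw [hf'old j hj v hv] at hvx
            exact hvx ▸ mem_image_of_mem f hv
          rw [show k - i = k - (i + 1) + 1 by omega] at hb'
          exact hb'.of_succ
        · refine hb b hbi fun x => ?_
          obtain ⟨v, hv, hvx⟩ := mem_image.1 (hbY x)
          rw [hf'new v hv] at hvx
          exact hvx ▸ hgT v hv
  obtain ⟨f, hfi, hfa, -⟩ := main k le_rfl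
  have hcov' : ∀ v, ∃ j : Fin (k + 1), (j : ℕ) ≤ k ∧ v ∈ Y j := fun v =>
    (hcov v).imp fun j hj => ⟨Nat.lt_succ_iff.1 j.2, hj⟩
  refine ⟨f, fun u v huv => hfi u v (hcov' u) (hcov' v) huv, fun u v huv => ?_⟩
  obtain ⟨j, ⟨hu, hv⟩ | ⟨hv, hu⟩⟩ := (hadj u v).1 huv
  · exact hfa j j.2 u hu v hv
  · exact (hfa j j.2 v hv u hu).symm

/-- **Grósz–Janzer–Nagy, Theorem 8.** If `L` is an `(r,t)`-blownup tree of size `k`,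
then `ex(n, L) = O(n^{2 - 1/r})`, with the implied constant depending only on
`r`, `t` and `k`. -/
theorem blownup_tree_turan (r t k : ℕ) (hr : 1 ≤ r) (hrt : r ≤ t) (hk : 1 ≤ k) :
    ∃ C : ℝ, ∀ (V : Type) (L : SimpleGraph V), IsBlownupTree r t k L →
      ∀ (n : ℕ) (G : SimpleGraph (Fin n)) [DecidableRel G.Adj],
        ¬ ContainsCopy L G →
        (G.edgeFinset.card : ℝ) ≤ C * (n : ℝ) ^ (2 - 1 / (r : ℝ)) := by
  classical
  obtain ⟨A, hA⟩ := exists_forall_sum_not_isRich_le r t ((k + 1) * t) (k + 1) hrt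
  refine ⟨(A : ℝ) + 1, fun V L hL n G _ hG => ?_⟩
  have hpoor : ∀ a : Fin r → Fin n, ¬ IsRich G t ((k + 1) * t) (k + 1) a :=
    fun a ha => hG (containsCopy_of_isRich hr hrt hL ha)
  have hle := hA n G
  rw [Finset.filter_true_of_mem fun a _ => hpoor a] at hle
  have hmain : G.edgeFinset.card ^ (r * r) ≤ A * n ^ (r * (2 * r - 1)) := by
    calc G.edgeFinset.card ^ (r * r) ≤ (2 * G.edgeFinset.card) ^ (r * r) :=
          Nat.pow_le_pow_left (Nat.le_mul_of_pos_left _ two_pos) _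
      _ ≤ n ^ (2 * (r * (r - 1))) * (A * n ^ r) :=
          (two_mul_card_edgeFinset_pow_le hr G).trans (Nat.mul_le_mul_left _ hle)
      _ = A * n ^ (r * (2 * r - 1)) := by
          rw [mul_left_comm, ← pow_add]
          congr 2
          obtain ⟨m, rfl⟩ := Nat.exists_eq_add_of_le' hr
          rw [Nat.add_sub_cancel, show 2 * (m + 1) - 1 = 2 * m + 1 by omega]
          ring
  have hr0 : (r : ℝ) ≠ 0 := by positivity
  have hexp : ((n : ℝ) ^ (2 - 1 / (r : ℝ))) ^ (r * r) = (n : ℝ) ^ (r * (2 * r - 1)) := by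
    rw [← Real.rpow_natCast, ← Real.rpow_mul n.cast_nonneg, ← Real.rpow_natCast]
    congr 1
    rw [Nat.cast_mul, Nat.cast_mul, Nat.cast_sub (by omega)]
    push_cast
    field_simp
  refine le_of_pow_le_pow_left₀ (n := r * r) (by positivity) (by positivity) ?_
  rw [mul_pow, hexp]
  calc (G.edgeFinset.card : ℝ) ^ (r * r) ≤ A * (n : ℝ) ^ (r * (2 * r - 1)) := by
        exact_mod_cast hmain
    _ ≤ ((A : ℝ) + 1) ^ (r * r) * (n : ℝ) ^ (r * (2 * r - 1)) := by
        gcongr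
        exact (le_add_of_nonneg_right zero_le_one).trans
          (le_self_pow₀ (by simp) (by positivity))
end

section
/- Let F be a finite bipartite graph with parts X and Y such that every vertex of X has degree at most r. Then there exists a constant C depending only on F such that for all n, ex(n, F) ≤ C · n^{2 - 1/r}. -/
open Finset in
/-- Dependent random choice: a graph with many stars with `k + 1` leaves has a large set of
vertices in which any `k + 1` vertices have many common neighbours. -/
theorem SimpleGraph.exists_finset_le_card_commonNeighbors {W : Type*} [Fintype W] [DecidableEq W]
    (G : SimpleGraph W) [DecidableRel G.Adj] (k m : ℕ)
    (h : (m ^ (k + 1) + m) * Fintype.card W ^ (k + 1) < ∑ v, G.degree v ^ (k + 1)) :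
    ∃ A : Finset W, m ≤ #A ∧
      ∀ s : Fin (k + 1) → W, (∀ i, s i ∈ A) → m ≤ #{t | ∀ i, G.Adj (s i) t} := by
  let A (T : Fin (k + 1) → W) : Finset W := {v | ∀ j, G.Adj v (T j)}
  let B (T : Fin (k + 1) → W) : Finset (Fin (k + 1) → W) :=
    {s | #{t | ∀ i, G.Adj (s i) t} < m ∧ ∀ i, s i ∈ A T}
  have sum_card_A : ∑ T, #(A T) = ∑ v, G.degree v ^ (k + 1) := by
    simp_rw [A, card_filter]
    rw [sum_comm]
    refine sum_congr rfl fun v _ ↦ ?_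
    rw [← card_filter, ← G.card_neighborFinset_eq_degree, ← Fintype.card_piFinset_const]
    congr 1
    ext T
    simp
  have sum_card_B : ∑ T, #(B T) ≤ m ^ (k + 1) * Fintype.card W ^ (k + 1) := by
    simp_rw [B, card_filter]
    rw [sum_comm]
    calc _ ≤ ∑ s : Fin (k + 1) → W, m ^ (k + 1) := by
          refine sum_le_sum fun s _ ↦ ?_
          rw [← card_filter]
          by_cases hs : #{t | ∀ i, G.Adj (s i) t} < m
          · refine le_trans (le_of_eq ?_) (Nat.pow_le_pow_left hs.le (k + 1))
            rw [← Fintype.card_piFinset_const]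
            congr 1
            ext T
            simpa [hs, A] using forall_comm
          · simp [hs]
      _ = _ := by simp [mul_comm]
  obtain ⟨T, -, hT⟩ : ∃ T ∈ univ, m + #(B T) < #(A T) := by
    apply exists_lt_of_sum_lt
    rw [sum_card_A, sum_add_distrib]
    refine lt_of_le_of_lt ?_ h
    simp only [sum_const, card_univ, Fintype.card_fun, Fintype.card_fin, smul_eq_mul]
    linarith
  refine ⟨A T \ (B T).image fun s : Fin (k + 1) → W ↦ s 0, ?_, fun s hs ↦ ?_⟩
  · have := le_card_sdiff ((B T).image fun s : Fin (k + 1) → W ↦ s 0) (A T)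
    have := card_image_le (s := B T) (f := fun s : Fin (k + 1) → W ↦ s 0)
    omega
  · by_contra! hlt
    refine (mem_sdiff.1 (hs 0)).2 (mem_image_of_mem (fun s : Fin (k + 1) → W ↦ s 0) ?_)
    exact mem_filter.2 ⟨mem_univ _, hlt, fun i ↦ (mem_sdiff.1 (hs i)).1⟩

open Finset in
/-- A graph with a large set of vertices in which any `k + 1` vertices have many common neighbours
contains every small bipartite graph whose degrees on one side are at most `k + 1`. -/
theorem ContainsCopy.of_le_card_commonNeighbors {V W : Type*} [Fintype V] [Fintype W]
    [DecidableEq W] (F : SimpleGraph V) [DecidableRel F.Adj] (G : SimpleGraph W)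
    [DecidableRel G.Adj] (k : ℕ) (X Y : Finset V) (hdisj : Disjoint X Y)
    (hbip : ∀ u v, F.Adj u v → (u ∈ X ∧ v ∈ Y) ∨ (u ∈ Y ∧ v ∈ X))
    (hdeg : ∀ x ∈ X, F.degree x ≤ k + 1) (A : Finset W) (hA : Fintype.card V ≤ #A)
    (h : ∀ s : Fin (k + 1) → W, (∀ i, s i ∈ A) →
      Fintype.card V ≤ #{t | ∀ i, G.Adj (s i) t}) :
    ContainsCopy F G := by
  classical
  obtain ⟨f⟩ : Nonempty (V ↪ A) := Function.Embedding.nonempty_of_card_le (by simpa using hA)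
  let C (v : V) : Finset W :=
    if v ∈ X then ({t | ∀ y, F.Adj v y → G.Adj (f y) t} : Finset W) else {(f v : W)}
  have card_C (x : V) (hx : x ∈ X) : Fintype.card V ≤ #(C x) := by
    obtain ⟨s, hsA, hs⟩ : ∃ s : Fin (k + 1) → W, (∀ i, s i ∈ A) ∧
        ∀ y, F.Adj x y → ∃ i, s i = f y := by
      rcases (F.neighborFinset x).eq_empty_or_nonempty with he | hne
      · refine ⟨fun _ ↦ f x, fun _ ↦ (f x).2, fun y hy ↦ ?_⟩
        rw [← F.mem_neighborFinset, he] at hy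
        simp at hy
      · have := hne.to_subtype
        obtain ⟨e⟩ : Nonempty (F.neighborFinset x ↪ Fin (k + 1)) :=
          Function.Embedding.nonempty_of_card_le (by
            rw [Fintype.card_coe, Fintype.card_fin]
            exact hdeg x hx)
        refine ⟨fun i ↦ f (Function.invFun e i : F.neighborFinset x), fun i ↦ (f _).2, fun y hy ↦
          ⟨e ⟨y, (F.mem_neighborFinset x y).2 hy⟩, ?_⟩⟩
        beta_reduce
        rw [Function.leftInverse_invFun e.injective]
    refine (h s hsA).trans (card_le_card fun t ht ↦ ?_)
    simp only [C, hx, if_true, mem_filter_univ] at ht ⊢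
    intro y hy
    obtain ⟨i, hi⟩ := hs y hy
    exact hi ▸ ht i
  obtain ⟨g, hg, hgC⟩ : ∃ g : V → W, Function.Injective g ∧ ∀ v, g v ∈ C v := by
    refine (all_card_le_biUnion_card_iff_exists_injective C).1 fun S ↦ ?_
    by_cases hS : ∃ x ∈ S, x ∈ X
    · obtain ⟨x, hxS, hx⟩ := hS
      exact (card_le_univ S).trans
        ((card_C x hx).trans (card_le_card (subset_biUnion_of_mem C hxS)))
    · push Not at hS
      rw [← card_image_of_injective S (Subtype.val_injective.comp f.injective)]
      refine card_le_card fun w hw ↦ ?_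
      obtain ⟨v, hv, rfl⟩ := mem_image.1 hw
      exact mem_biUnion.2 ⟨v, hv, by simp [C, hS v hv]⟩
  have adj (x y : V) (hx : x ∈ X) (hy : y ∈ Y) (hxy : F.Adj x y) : G.Adj (g x) (g y) := by
    have h₁ := hgC x
    have h₂ := hgC y
    simp only [C, hx, if_true, mem_filter_univ] at h₁
    simp only [C, disjoint_right.1 hdisj hy, if_false, mem_singleton] at h₂
    exact h₂ ▸ (h₁ y hxy).symm
  refine ⟨g, hg, fun a b hab ↦ ?_⟩
  rcases hbip a b hab with ⟨ha, hb⟩ | ⟨ha, hb⟩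
  · exact adj a b ha hb hab
  · exact (adj b a hb ha hab.symm).symm

/-- **Füredi's theorem.** If `F` is a bipartite graph with parts `X` and `Y` such
that every vertex of `X` has degree at most `r`, then `ex(n, F) ≤ C · n^{2 - 1/r}`
for a constant `C` depending only on `F`. -/
theorem semiregular_bipartite_turan {V : Type} [Fintype V] (F : SimpleGraph V)
    [DecidableRel F.Adj] (r : ℕ) (hr : 1 ≤ r) (X Y : Finset V)
    (hdisj : Disjoint X Y) (hcover : ∀ v : V, v ∈ X ∨ v ∈ Y)
    (hbip : ∀ u v, F.Adj u v → (u ∈ X ∧ v ∈ Y) ∨ (u ∈ Y ∧ v ∈ X))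
    (hdeg : ∀ x ∈ X, F.degree x ≤ r) :
    ∃ C : ℝ, ∀ (n : ℕ) (G : SimpleGraph (Fin n)) [DecidableRel G.Adj],
      ¬ ContainsCopy F G →
      (G.edgeFinset.card : ℝ) ≤ C * (n : ℝ) ^ (2 - 1 / (r : ℝ)) := by
  obtain ⟨k, rfl⟩ : ∃ k, r = k + 1 := ⟨r - 1, by omega⟩
  set m := Fintype.card V
  let C : ℝ := m ^ (k + 1) + m + 1
  have hC : 1 ≤ C := by simp only [C]; linarith [show (0 : ℝ) ≤ m ^ (k + 1) + m by positivity]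
  refine ⟨C, fun n G _ hG ↦ ?_⟩
  contrapose! hG
  suffices h : (m ^ (k + 1) + m) * Fintype.card (Fin n) ^ (k + 1) <
      ∑ v, G.degree v ^ (k + 1) by
    obtain ⟨A, hA, hs⟩ := G.exists_finset_le_card_commonNeighbors k m h
    exact .of_le_card_commonNeighbors F G k X Y hdisj hbip hdeg A hA hs
  have hn : 0 < (n : ℝ) := by
    rcases Nat.eq_zero_or_pos n with rfl | hn
    · have : 0 ≤ C * ((0 : ℕ) : ℝ) ^ (2 - 1 / ((k + 1 : ℕ) : ℝ)) := by positivity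
      have he : G.edgeFinset = ∅ := by
        ext e
        exact e.ind fun a _ ↦ a.elim0
      simp [he] at hG
      simp at this
      linarith
    · exact_mod_cast hn
  have rpow_pow : ((n : ℝ) ^ (2 - 1 / ((k + 1 : ℕ) : ℝ))) ^ (k + 1) = n ^ k * n ^ (k + 1) := by
    rw [← Real.rpow_natCast, ← Real.rpow_mul hn.le, ← pow_add, ← Real.rpow_natCast]
    congr 1
    push_cast
    field_simp
    ring
  have sum_degrees : ∑ v, (G.degree v : ℝ) = 2 * G.edgeFinset.card := by
    exact_mod_cast G.sum_degrees_eq_twice_card_edges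
  have jensen : (∑ v, (G.degree v : ℝ)) ^ (k + 1) ≤ n ^ k * ∑ v, (G.degree v : ℝ) ^ (k + 1) := by
    simpa using pow_sum_le_card_mul_sum_pow (s := Finset.univ)
      (fun v _ ↦ Nat.cast_nonneg' (α := ℝ) (G.degree v)) k
  have edges : C * (n ^ k * n ^ (k + 1)) ≤ (∑ v, (G.degree v : ℝ)) ^ (k + 1) := calc
    _ ≤ C ^ (k + 1) * (n ^ k * n ^ (k + 1)) := by
      gcongr
      exact le_self_pow₀ hC k.succ_ne_zero
    _ = (C * (n : ℝ) ^ (2 - 1 / ((k + 1 : ℕ) : ℝ))) ^ (k + 1) := by rw [mul_pow, rpow_pow]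
    _ ≤ _ := by
      gcongr
      linarith [(Nat.cast_nonneg G.edgeFinset.card : (0 : ℝ) ≤ _)]
  have key : (n : ℝ) ^ k * (C * n ^ (k + 1)) ≤ n ^ k * ∑ v, (G.degree v : ℝ) ^ (k + 1) := by
    linarith
  have := le_of_mul_le_mul_left key (by positivity)
  have hlt : ((m : ℝ) ^ (k + 1) + m) * n ^ (k + 1) < C * n ^ (k + 1) := by
    gcongr
    simp [C]
  rw [Fintype.card_fin]
  exact_mod_cast hlt.trans_le this
end

section
/- For any positive integers r ≤ t there exist constants γ' > 0 and c > 0 such that every simple graph G on n vertices with e edges, where e ≥ c · n^{2 - 1/r}, contains at least γ' · e^{rt} / n^{2rt - r - t} copies of the complete bipartite graph K_{r,t}. -/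
open Finset

/-- The number of copies of the complete bipartite graph `K_{r,t}` in `G`, counted as
ordered pairs `(R, S)` of disjoint vertex sets with `|R| = r`, `|S| = t` and every
vertex of `R` adjacent to every vertex of `S`.  For `r < t` this is exactly the number
of (unordered) copies of `K_{r,t}` in `G`; for `r = t` each unordered copy is counted
exactly twice. -/
def ktCopies (r t : ℕ) {n : ℕ} (G : SimpleGraph (Fin n)) [DecidableRel G.Adj] : ℕ :=
  ((Finset.univ.powersetCard r ×ˢ Finset.univ.powersetCard t).filter
    (fun p => Disjoint p.1 p.2 ∧ ∀ a ∈ p.1, ∀ b ∈ p.2, G.Adj a b)).card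

/-- Power-mean lower bound for a sum of binomial coefficients in terms of the sum of the
upper indices. -/
theorem pow_le_factorial_mul_sum_choose {ι : Type*} (s : Finset ι) (f : ι → ℕ) (k N : ℕ)
    (hk : 1 ≤ k) (hN : s.card ≤ N) (x : ℝ) (hx : 0 ≤ x)
    (h : x + k * N ≤ ∑ i ∈ s, (f i : ℝ)) :
    x ^ k ≤ (k.factorial : ℝ) * (N : ℝ) ^ (k - 1) * ∑ i ∈ s, ((f i).choose k : ℝ) := by
  obtain ⟨m, rfl⟩ : ∃ m, k = m + 1 := ⟨k - 1, by omega⟩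
  have hxs : x ≤ ∑ i ∈ s, ((f i - m : ℕ) : ℝ) := by
    have h1 : ∑ i ∈ s, (f i : ℝ) ≤ ∑ i ∈ s, (((f i - m : ℕ) : ℝ) + m) := by
      refine Finset.sum_le_sum fun i _ => ?_
      exact_mod_cast (by omega : f i ≤ f i - m + m)
    rw [Finset.sum_add_distrib, Finset.sum_const, nsmul_eq_mul] at h1
    have h2 : (s.card : ℝ) * m ≤ N * m := by gcongr
    push_cast at h
    nlinarith [(Nat.cast_nonneg N : (0 : ℝ) ≤ N)]
  calc x ^ (m + 1) ≤ (∑ i ∈ s, ((f i - m : ℕ) : ℝ)) ^ (m + 1) := by gcongr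
    _ ≤ (s.card : ℝ) ^ m * ∑ i ∈ s, ((f i - m : ℕ) : ℝ) ^ (m + 1) :=
        pow_sum_le_card_mul_sum_pow (fun i _ => Nat.cast_nonneg _) m
    _ ≤ (N : ℝ) ^ m * ∑ i ∈ s, (((m + 1).factorial : ℝ) * ((f i).choose (m + 1) : ℝ)) := by
        gcongr with i hi
        have h3 := Nat.pow_sub_le_descFactorial (f i) (m + 1)
        rw [Nat.descFactorial_eq_factorial_mul_choose, Nat.add_sub_add_right] at h3
        exact_mod_cast h3
    _ = _ := by
        rw [← Finset.mul_sum, Nat.add_sub_cancel]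
        ring

theorem ktCopies_eq_sum_choose (r t : ℕ) {n : ℕ} (G : SimpleGraph (Fin n))
    [DecidableRel G.Adj] :
    ktCopies r t G = ∑ R ∈ (univ : Finset (Fin n)).powersetCard r,
      (univ.filter fun v => ∀ a ∈ R, G.Adj a v).card.choose t := by
  rw [ktCopies, card_filter, sum_product]
  refine sum_congr rfl fun R _ => ?_
  rw [← card_filter, ← card_powersetCard]
  congr 1
  ext S
  simp only [mem_filter, mem_powersetCard, mem_univ, implies_true, true_and, subset_iff]
  constructor
  · rintro ⟨h1, -, h3⟩
    exact ⟨fun b hb a ha => h3 a ha b hb, h1⟩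
  · rintro ⟨h1, h2⟩
    refine ⟨h2, ?_, fun a ha b hb => h1 hb a ha⟩
    exact disjoint_left.mpr fun a ha hb => G.loopless.irrefl a (h1 hb a ha)

theorem sum_choose_degree_eq_sum_card_common_neighbors (r : ℕ) {n : ℕ}
    (G : SimpleGraph (Fin n)) [DecidableRel G.Adj] :
    ∑ v, (G.degree v).choose r = ∑ R ∈ (univ : Finset (Fin n)).powersetCard r,
      (univ.filter fun v => ∀ a ∈ R, G.Adj a v).card := by
  have h := sum_card_bipartiteAbove_eq_sum_card_bipartiteBelow
    (s := (univ : Finset (Fin n)).powersetCard r) (t := univ)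
    (fun (R : Finset (Fin n)) v => ∀ a ∈ R, G.Adj a v)
  unfold bipartiteAbove bipartiteBelow at h
  rw [h]
  refine sum_congr rfl fun v _ => ?_
  rw [← SimpleGraph.card_neighborFinset_eq_degree, ← card_powersetCard]
  congr 1
  ext R
  simp [mem_powersetCard, subset_iff, and_comm, G.adj_comm v]

/-- **Erdős–Simonovits supersaturation, strong form.**  For positive integers
`r ≤ t` there are constants `γ' > 0` and `c > 0` such that every graph on `n`
vertices with `e ≥ c · n^{2 - 1/r}` edges contains at least
`γ' · e^{rt} / n^{2rt - r - t}` copies of `K_{r,t}`.  (Copies are unordered; since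
`ktCopies` counts ordered pairs, for `r = t` each unordered copy is counted twice,
whence the factor `2` in that case.) -/
theorem supersaturation_strong (r t : ℕ) (hr : 1 ≤ r) (hrt : r ≤ t) :
    ∃ γ' c : ℝ, 0 < γ' ∧ 0 < c ∧
      ∀ (n : ℕ) (G : SimpleGraph (Fin n)) [DecidableRel G.Adj],
        c * (n : ℝ) ^ (2 - 1 / (r : ℝ)) ≤ (G.edgeFinset.card : ℝ) →
        (if r = t then 2 * γ' else γ') * (G.edgeFinset.card : ℝ) ^ (r * t)
            / (n : ℝ) ^ (2 * r * t - r - t) ≤ (ktCopies r t G : ℝ) := by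
  set F : ℝ := (r.factorial : ℝ) with hF
  set T : ℝ := (t.factorial : ℝ) with hT
  have hF1 : 1 ≤ F := by
    rw [hF]; exact_mod_cast Nat.one_le_iff_ne_zero.mpr r.factorial_ne_zero
  have hT1 : 1 ≤ T := by
    rw [hT]; exact_mod_cast Nat.one_le_iff_ne_zero.mpr t.factorial_ne_zero
  have hr1 : (1 : ℝ) ≤ r := by exact_mod_cast hr
  have hrt1 : (r : ℝ) ≤ t := by exact_mod_cast hrt
  have hc : (2 * t : ℝ) ≤ 2 * t * F := by nlinarith
  refine ⟨1 / (2 * (T * (2 * F) ^ t)), 2 * t * F, by positivity, by nlinarith, ?_⟩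
  intro n G _ he
  set e : ℝ := (G.edgeFinset.card : ℝ) with he_def
  have he0 : 0 ≤ e := Nat.cast_nonneg _
  rcases Nat.eq_zero_or_pos n with rfl | hn
  · have : e = 0 := by simp [he_def, Subsingleton.elim G ⊥]
    rw [this, zero_pow (Nat.mul_ne_zero (by omega) (by omega))]
    simp
  have hn1 : (1 : ℝ) ≤ n := by exact_mod_cast hn
  have hn0 : (0 : ℝ) < n := by linarith
  have hinv : 1 / (r : ℝ) ≤ 1 := by rw [div_le_one (by linarith)]; exact hr1
  have hne : (r : ℝ) * n ≤ e := by
    have h1 : (n : ℝ) ≤ (n : ℝ) ^ (2 - 1 / (r : ℝ)) := by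
      conv_lhs => rw [← Real.rpow_one (n : ℝ)]
      exact Real.rpow_le_rpow_of_exponent_le hn1 (by linarith)
    calc (r : ℝ) * n ≤ 2 * t * F * (n : ℝ) ^ (2 - 1 / (r : ℝ)) := by gcongr; linarith
      _ ≤ e := he
  have hdeg : ∑ v, (G.degree v : ℝ) = 2 * e := by
    rw [he_def]
    exact_mod_cast G.sum_degrees_eq_twice_card_edges
  set P : ℝ := ∑ v, ((G.degree v).choose r : ℝ) with hP
  have hP1 : e ^ r ≤ F * (n : ℝ) ^ (r - 1) * P :=
    pow_le_factorial_mul_sum_choose univ (fun v => G.degree v) r n hr (by simp) e he0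
      (by rw [hdeg]; linarith)
  have hpow : (2 * t * F) * (n : ℝ) ^ (2 * r - 1) ≤ e ^ r := by
    have h1 : ((n : ℝ) ^ (2 - 1 / (r : ℝ))) ^ r = (n : ℝ) ^ (2 * r - 1) := by
      rw [← Real.rpow_mul_natCast hn0.le, ← Real.rpow_natCast]
      congr 1
      rw [Nat.cast_sub (by omega)]
      push_cast
      field_simp
    calc (2 * t * F) * (n : ℝ) ^ (2 * r - 1)
        ≤ (2 * t * F) ^ r * (n : ℝ) ^ (2 * r - 1) := by
          gcongr
          exact le_self_pow₀ (by nlinarith) (by omega)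
      _ = (2 * t * F * (n : ℝ) ^ (2 - 1 / (r : ℝ))) ^ r := by rw [mul_pow _ ((n : ℝ) ^ _), h1]
      _ ≤ e ^ r := by gcongr
  have hP2 : 2 * t * (n : ℝ) ^ r ≤ P := by
    have h1 : (n : ℝ) ^ (2 * r - 1) = (n : ℝ) ^ (r - 1) * (n : ℝ) ^ r := by
      rw [← pow_add]; congr 1; omega
    rw [h1] at hpow
    have h2 : F * (n : ℝ) ^ (r - 1) * (2 * t * (n : ℝ) ^ r) ≤ F * (n : ℝ) ^ (r - 1) * P := by
      linarith
    exact le_of_mul_le_mul_left h2 (by positivity)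
  have hcount : P = ∑ R ∈ (univ : Finset (Fin n)).powersetCard r,
      ((univ.filter fun v => ∀ a ∈ R, G.Adj a v).card : ℝ) := by
    rw [hP]
    exact_mod_cast sum_choose_degree_eq_sum_card_common_neighbors r G
  have hP0 : 0 ≤ P := le_trans (by positivity) hP2
  have hK : (P / 2) ^ t ≤ T * ((n : ℝ) ^ r) ^ (t - 1) * (ktCopies r t G : ℝ) := by
    have h := pow_le_factorial_mul_sum_choose ((univ : Finset (Fin n)).powersetCard r)
      (fun R => (univ.filter fun v => ∀ a ∈ R, G.Adj a v).card) t (n ^ r) (by omega)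
      (by rw [card_powersetCard, card_univ, Fintype.card_fin]; exact Nat.choose_le_pow n r)
      (P / 2) (by positivity) (by rw [← hcount]; push_cast; linarith)
    rw [ktCopies_eq_sum_choose]
    push_cast at h ⊢
    exact h
  have hmain : e ^ (r * t) ≤
      T * (2 * F) ^ t * (n : ℝ) ^ (2 * r * t - r - t) * (ktCopies r t G : ℝ) := by
    have hexp : 2 * r * t - r - t = (r - 1) * t + r * (t - 1) := by
      obtain ⟨a, rfl⟩ : ∃ a, r = a + 1 := ⟨r - 1, by omega⟩
      obtain ⟨b, rfl⟩ : ∃ b, t = b + 1 := ⟨t - 1, by omega⟩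
      have : 2 * (a + 1) * (b + 1) = a * (b + 1) + (a + 1) * b + (b + 1) + (a + 1) := by ring
      simp only [Nat.add_sub_cancel]
      omega
    calc e ^ (r * t) = (e ^ r) ^ t := pow_mul _ _ _
      _ ≤ (F * (n : ℝ) ^ (r - 1) * P) ^ t := by gcongr
      _ = (2 * F) ^ t * (n : ℝ) ^ ((r - 1) * t) * (P / 2) ^ t := by
          rw [pow_mul, ← mul_pow, ← mul_pow]
          congr 1
          ring
      _ ≤ (2 * F) ^ t * (n : ℝ) ^ ((r - 1) * t) *
          (T * ((n : ℝ) ^ r) ^ (t - 1) * (ktCopies r t G : ℝ)) := by gcongr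
      _ = _ := by
          rw [hexp, pow_add, pow_mul _ r (t - 1)]
          ring
  have hT0 : 0 < T * (2 * F) ^ t := by positivity
  have hcoef : (if r = t then 2 * (1 / (2 * (T * (2 * F) ^ t))) else 1 / (2 * (T * (2 * F) ^ t)))
      ≤ 1 / (T * (2 * F) ^ t) := by
    have h1 : 2 * (1 / (2 * (T * (2 * F) ^ t))) = 1 / (T * (2 * F) ^ t) := by field_simp
    have h2 : 0 < 1 / (2 * (T * (2 * F) ^ t)) := by positivity
    split_ifs <;> linarith
  rw [div_le_iff₀ (by positivity)]
  calc _ ≤ 1 / (T * (2 * F) ^ t) * e ^ (r * t) := by gcongr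
    _ ≤ 1 / (T * (2 * F) ^ t) *
        (T * (2 * F) ^ t * (n : ℝ) ^ (2 * r * t - r - t) * (ktCopies r t G : ℝ)) := by gcongr
    _ = _ := by field_simp
end

section
/- Let F be a finite bipartite graph with nonempty parts X and Y such that every vertex of X has degree at most r and r ≤ |Y|. Then there exist an integer t with r ≤ t and a positive integer k such that F is isomorphic to a subgraph of some (r,t)-blownup tree of size k. (In fact one may take t = |Y|.) -/
/-- Layers `Y` and attaching sets `X` satisfying the vertex conditions in the definition of a
blown-up tree determine such a tree. -/
theorem exists_isBlownupTree_of_layers {r t k : ℕ} {W : Type*}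
    (Y : Fin (k + 1) → Finset W) (X : Fin k → Finset W)
    (hY : ∀ i j : Fin (k + 1), i ≠ j → Disjoint (Y i) (Y j))
    (hY₀ : (Y 0).card = r) (hYt : ∀ i : Fin (k + 1), i ≠ 0 → (Y i).card = t)
    (hcover : ∀ v : W, ∃ i, v ∈ Y i) (hXr : ∀ i : Fin k, (X i).card = r)
    (hX₀ : ∀ i : Fin k, (i : ℕ) = 0 → X i = Y 0)
    (hXY : ∀ i : Fin k, ∃ j : Fin (k + 1), (j : ℕ) ≤ (i : ℕ) ∧ X i ⊆ Y j) :
    ∃ L : SimpleGraph W, IsBlownupTree r t k L ∧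
      ∀ i : Fin k, ∀ u ∈ X i, ∀ v ∈ Y i.succ, L.Adj u v := by
  have hXY' (i : Fin k) : Disjoint (X i) (Y i.succ) := by
    obtain ⟨j, hji, hj⟩ := hXY i
    refine (hY j i.succ fun h => ?_).mono_left hj
    have := congrArg Fin.val h
    simp only [Fin.val_succ] at this
    omega
  let L : SimpleGraph W :=
    { Adj := fun u v => ∃ i : Fin k, (u ∈ X i ∧ v ∈ Y i.succ) ∨ (v ∈ X i ∧ u ∈ Y i.succ)
      symm := ⟨fun _ _ ⟨i, hi⟩ => ⟨i, hi.symm⟩⟩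
      loopless := ⟨fun u ⟨i, hi⟩ => by
        have h : u ∈ X i ∧ u ∈ Y i.succ := hi.elim id id
        exact Finset.disjoint_left.mp (hXY' i) h.1 h.2⟩ }
  exact ⟨L, ⟨Y, X, hY, hY₀, hYt, hcover, hXr, hX₀, hXY, fun _ _ => Iff.rfl⟩,
    fun i _ hu _ hv => ⟨i, Or.inl ⟨hu, hv⟩⟩⟩

/-- Given `n` subsets of size `r` of a finite type `β`, there is a blown-up tree consisting of a
root of size `r`, a copy of `β` attached to it, and `n` further copies of `β`, the `i`-th of which
is attached to the `i`-th subset of the first copy. -/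
theorem exists_isBlownupTree_of_subsets {β : Type} [Fintype β] {r n : ℕ} (S : Fin n → Finset β)
    (hS : ∀ i, (S i).card = r) :
    ∃ L : SimpleGraph (Fin r ⊕ Fin (n + 1) × β), IsBlownupTree r (Fintype.card β) (n + 1) L ∧
      ∀ i, ∀ y ∈ S i, ∀ z, L.Adj (Sum.inr (0, y)) (Sum.inr (i.succ, z)) := by
  let layer (i : Fin (n + 1)) : β ↪ Fin r ⊕ Fin (n + 1) × β :=
    (Function.Embedding.sectR i β).trans Function.Embedding.inr
  let Y : Fin (n + 2) → Finset (Fin r ⊕ Fin (n + 1) × β) :=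
    Fin.cases (Finset.univ.map Function.Embedding.inl) fun i => Finset.univ.map (layer i)
  let X : Fin (n + 1) → Finset (Fin r ⊕ Fin (n + 1) × β) :=
    Fin.cases (Y 0) fun i => (S i).map (layer 0)
  suffices h : ∃ L : SimpleGraph (Fin r ⊕ Fin (n + 1) × β),
      IsBlownupTree r (Fintype.card β) (n + 1) L ∧
        ∀ i : Fin (n + 1), ∀ u ∈ X i, ∀ v ∈ Y i.succ, L.Adj u v by
    obtain ⟨L, hL, hadj⟩ := h
    exact ⟨L, hL, fun i y hy z => hadj i.succ _ (Finset.mem_map_of_mem (layer 0) hy) _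
      (Finset.mem_map_of_mem (layer i.succ) (Finset.mem_univ z))⟩
  refine exists_isBlownupTree_of_layers Y X ?_ ?_ ?_ ?_ ?_ ?_ ?_
  · intro i j hij
    cases i using Fin.cases <;> cases j using Fin.cases <;>
      simp_all [Y, layer, Finset.disjoint_left, eq_comm]
  · simp [Y]
  · intro i hi
    cases i using Fin.cases <;> simp_all [Y]
  · rintro (a | ⟨i, b⟩)
    · exact ⟨0, by simp [Y]⟩
    · exact ⟨i.succ, by simp [Y, layer]⟩
  · intro i
    cases i using Fin.cases <;> simp [X, Y, hS]
  · intro i hi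
    obtain rfl : i = 0 := Fin.ext hi
    rfl
  · intro i
    cases i using Fin.cases with
    | zero => exact ⟨0, le_rfl, subset_rfl⟩
    | succ i =>
      exact ⟨Fin.succ 0, by simp, Finset.map_subset_map.mpr (Finset.subset_univ _)⟩

/-- Every bipartite graph `F` with nonempty parts `X`, `Y` in which every vertex of
`X` has degree at most `r` (where `r ≤ |Y|`) is a subgraph of some `(r,t)`-blownup
tree (one may take `t = |Y|`). -/
theorem bipartite_subgraph_of_blownup_tree {V : Type} [Fintype V] (F : SimpleGraph V)
    [DecidableRel F.Adj] (r : ℕ) (hr : 1 ≤ r) (X Y : Finset V)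
    (hX : X.Nonempty) (hYne : Y.Nonempty)
    (hdisj : Disjoint X Y) (hcover : ∀ v : V, v ∈ X ∨ v ∈ Y)
    (hbip : ∀ u v, F.Adj u v → (u ∈ X ∧ v ∈ Y) ∨ (u ∈ Y ∧ v ∈ X))
    (hdeg : ∀ x ∈ X, F.degree x ≤ r) (hrY : r ≤ Y.card) :
    ∃ t k : ℕ, r ≤ t ∧ 1 ≤ k ∧
      ∃ (W : Type) (L : SimpleGraph W), IsBlownupTree r t k L ∧ ContainsCopy F L := by
  classical
  have hN (x : X) : ∃ S : Finset Y, (∀ y : Y, F.Adj x y → y ∈ S) ∧ S.card = r := by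
    have hcard : (Finset.univ.filter fun y : Y => F.Adj x y).card ≤ r := by
      refine le_trans ?_ (hdeg x x.2)
      rw [← F.card_neighborFinset_eq_degree]
      exact Finset.card_le_card_of_injOn Subtype.val (by intro y; simp)
        Subtype.val_injective.injOn
    obtain ⟨S, hsub, hS⟩ := Finset.exists_superset_card_eq hcard (by simpa using hrY)
    exact ⟨S, fun y hy => hsub (by simpa using hy), hS⟩
  choose S hNS hS using hN
  obtain ⟨L, hL, hadj⟩ :=
    exists_isBlownupTree_of_subsets (fun i => S (X.equivFin.symm i)) fun i => hS _
  obtain ⟨y₀, hy₀⟩ := hYne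
  have hY (v : V) (h : v ∉ X) : v ∈ Y := (hcover v).resolve_left h
  let f (v : V) : Fin r ⊕ Fin (X.card + 1) × Y :=
    if h : v ∈ X then Sum.inr ((X.equivFin ⟨v, h⟩).succ, ⟨y₀, hy₀⟩)
    else Sum.inr (0, ⟨v, hY v h⟩)
  have key (x y : V) (hx : x ∈ X) (hy : y ∈ Y) (h : F.Adj x y) : L.Adj (f y) (f x) := by
    have hyX : y ∉ X := Finset.disjoint_right.mp hdisj hy
    simp only [f, dif_pos hx, dif_neg hyX]
    exact hadj _ _ (by simpa using hNS ⟨x, hx⟩ ⟨y, hy⟩ h) _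
  refine ⟨Fintype.card Y, X.card + 1, by simpa using hrY, by omega, _, L, hL, f, ?_, ?_⟩
  · intro a b hab
    by_cases ha : a ∈ X <;> by_cases hb : b ∈ X <;>
      simp_all [f, Fin.succ_ne_zero, (Fin.succ_ne_zero _).symm]
  · intro a b hab
    rcases hbip a b hab with ⟨ha, hb⟩ | ⟨ha, hb⟩
    · exact (key a b ha hb hab).symm
    · exact key b a hb ha hab.symm
end

section
/- Let F be a blow-up of a finite tree T, obtained by replacing each vertex u of T with a finite nonempty independent set I(u), and suppose F is r-degenerate. Then there exist positive integers t ≥ r and k, an (r,t)-blownup tree L with associated sets X_1,…,X_k and Y_0,Y_1,…,Y_k, and an injective graph homomorphism (embedding as a subgraph) φ from F into L such that for every vertex u of T, the image φ(I(u)) is contained in some single Y_i with 0 ≤ i ≤ k. -/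
/-- A rooted tree has a parent function: every non-root vertex is adjacent to its parent, which
has smaller depth, and every edge joins a vertex with its parent. -/
theorem SimpleGraph.IsTree.exists_parent {V : Type*} {T : SimpleGraph V} (hT : T.IsTree)
    (root : V) :
    ∃ (p : V → V) (d : V → ℕ), p root = root ∧
      (∀ y, y ≠ root → T.Adj (p y) y ∧ d (p y) < d y) ∧
      ∀ x y, T.Adj x y → (y ≠ root ∧ p y = x) ∨ (x ≠ root ∧ p x = y) := by
  choose q hq hlen using hT.connected.exists_path_of_dist root
  have key : ∀ x y, T.Adj x y → T.dist root y = T.dist root x + 1 →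
      y ≠ root ∧ (q y).penultimate = x := by
    intro x y hxy hd
    refine ⟨?_, ?_⟩
    · rintro rfl
      simp at hd
    · have hc : ((q x).concat hxy).IsPath := by
        apply SimpleGraph.Walk.isPath_of_length_eq_dist
        rw [SimpleGraph.Walk.length_concat, hlen, hd]
      rw [(hT.existsUnique_path root y).unique (hq y) hc, SimpleGraph.Walk.penultimate_concat]
  refine ⟨fun v => (q v).penultimate, T.dist root, ?_, ?_, ?_⟩
  · have h0 : (q root).length = 0 := by simp [hlen]
    simp [SimpleGraph.Walk.penultimate, h0]
  · intro y hy
    have hnil : ¬ (q y).Nil := SimpleGraph.Walk.not_nil_of_ne hy.symm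
    have hadj := SimpleGraph.Walk.adj_penultimate hnil
    refine ⟨hadj, ?_⟩
    rcases hT.dist_eq_dist_add_one_of_adj root hadj with h | h
    · exfalso
      have h1 := SimpleGraph.dist_le (q y).dropLast
      have h2 := congrArg SimpleGraph.Walk.length (SimpleGraph.Walk.concat_dropLast hadj)
      rw [SimpleGraph.Walk.length_concat, hlen] at h2
      lia
    · lia
  · intro x y hxy
    rcases hT.dist_eq_dist_add_one_of_adj root hxy with h | h
    · exact Or.inr (key y x hxy.symm h)
    · exact Or.inl (key x y hxy h)

/-- A degenerate graph contains no large complete bipartite subgraph. -/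
theorem Degenerate.card_le_of_complete {W : Type*} [Finite W] {F : SimpleGraph W} {r : ℕ}
    (hdeg : Degenerate r F) {A B : Set W} (hAB : ∀ a ∈ A, ∀ b ∈ B, F.Adj a b)
    (hA : r < A.ncard) : B.ncard ≤ r := by
  by_contra! hB
  obtain ⟨a, ha⟩ := Set.nonempty_of_ncard_ne_zero (by lia : A.ncard ≠ 0)
  obtain ⟨v, hv, hcard⟩ := hdeg ((⊤ : F.Subgraph).induce (A ∪ B)) ⟨a, Or.inl ha⟩
  rcases hv with hv | hv
  · refine (hcard.trans_lt hB).not_ge (Set.ncard_le_ncard ?_ (Set.toFinite _))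
    intro b hb
    simp [hv, hb, hAB v hv b hb]
  · refine (hcard.trans_lt hA).not_ge (Set.ncard_le_ncard ?_ (Set.toFinite _))
    intro b hb
    simp [hv, hb, (hAB b hb v hv).symm]

/-- A finite type can be enumerated compatibly with a depth function. -/
theorem exists_equiv_fin_of_depth (V : Type*) [Fintype V] (d : V → ℕ) :
    ∃ e : Fin (Fintype.card V) ≃ V, ∀ i j, d (e i) < d (e j) → i < j := by
  let e₀ := (Fintype.equivFin V).symm
  refine ⟨(Tuple.sort (d ∘ e₀)).trans e₀, fun i j h => ?_⟩
  by_contra! hji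
  exact absurd (Tuple.monotone_sort (d ∘ e₀) hji) (by simpa using h)

/-- A family of disjoint parts indexed by a set with a depth function, each attached to an
`r`-subset of the initial part or of a part of smaller depth, yields a blownup tree. -/
theorem exists_blownupTreeData {V Z : Type} [Fintype V] [Nonempty V] (d : V → ℕ) {r t : ℕ}
    (Y₀ : Finset Z) (Y X : V → Finset Z)
    (hdisj₀ : ∀ v, Disjoint Y₀ (Y v)) (hdisj : ∀ u v, u ≠ v → Disjoint (Y u) (Y v))
    (hY₀ : Y₀.card = r) (hY : ∀ v, (Y v).card = t)
    (hcover : ∀ z, z ∈ Y₀ ∨ ∃ v, z ∈ Y v) (hX : ∀ v, (X v).card = r)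
    (hXY : ∀ v, X v ⊆ Y₀ ∨ ∃ u, d u < d v ∧ X v ⊆ Y u) :
    ∃ k, 1 ≤ k ∧ ∃ (L : SimpleGraph Z) (Y' : Fin (k + 1) → Finset Z) (X' : Fin k → Finset Z),
      BlownupTreeData r t k L Y' X' ∧ (∀ v, ∃ i, Y' i = Y v) ∧
      ∀ v, ∀ x ∈ X v, ∀ y ∈ Y v, L.Adj x y := by
  obtain ⟨e, he⟩ := exists_equiv_fin_of_depth V d
  have hXd : ∀ v, Disjoint (X v) (Y v) := by
    intro v
    rcases hXY v with h | ⟨u, hu, h⟩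
    · exact (hdisj₀ v).mono_left h
    · exact (hdisj u v (by rintro rfl; exact lt_irrefl _ hu)).mono_left h
  let L : SimpleGraph Z :=
    { Adj := fun x y => ∃ v, (x ∈ X v ∧ y ∈ Y v) ∨ (y ∈ X v ∧ x ∈ Y v)
      symm := ⟨fun x y ⟨v, h⟩ => ⟨v, h.symm⟩⟩
      loopless := ⟨by
        rintro x ⟨v, h | h⟩ <;> exact Finset.disjoint_left.mp (hXd v) h.1 h.2⟩ }
  refine ⟨Fintype.card V, Fintype.card_pos, L, Fin.cons Y₀ fun i => Y (e i), fun i => X (e i),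
    ⟨?_, ?_, ?_, ?_, ?_, ?_, ?_, ?_⟩, ?_, ?_⟩
  · intro i j hij
    cases i using Fin.cases with
    | zero =>
      cases j using Fin.cases with
      | zero => exact absurd rfl hij
      | succ j => simpa using hdisj₀ (e j)
    | succ i =>
      cases j using Fin.cases with
      | zero => simpa using (hdisj₀ (e i)).symm
      | succ j =>
        simp only [Fin.cons_succ]
        exact hdisj _ _ fun h => hij (congrArg Fin.succ (e.injective h))
  · simpa using hY₀
  · intro i hi
    cases i using Fin.cases with
    | zero => exact absurd rfl hi
    | succ i => simpa using hY (e i)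
  · intro z
    rcases hcover z with h | ⟨v, h⟩
    · exact ⟨0, by simpa using h⟩
    · exact ⟨(e.symm v).succ, by simpa using h⟩
  · exact fun i => hX _
  · intro i hi
    rcases hXY (e i) with h | ⟨u, hu, -⟩
    · exact Finset.eq_of_subset_of_card_le h (by rw [hX, Fin.cons_zero, hY₀])
    · have := he (e.symm u) i (by simpa using hu)
      have : ((e.symm u : Fin _) : ℕ) < i := this
      lia
  · intro i
    rcases hXY (e i) with h | ⟨u, hu, h⟩
    · exact ⟨0, Nat.zero_le _, by simpa using h⟩
    · have hlt : ((e.symm u : Fin _) : ℕ) < i := he (e.symm u) i (by simpa using hu)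
      refine ⟨(e.symm u).succ, ?_, by simpa using h⟩
      rw [Fin.val_succ]
      exact hlt
  · intro u v
    simp only [Fin.cons_succ]
    exact ⟨fun ⟨w, h⟩ => ⟨e.symm w, by simpa using h⟩, fun ⟨i, h⟩ => ⟨e i, h⟩⟩
  · exact fun v => ⟨(e.symm v).succ, by simp⟩
  · exact fun v x hx y hy => ⟨v, Or.inl ⟨hx, hy⟩⟩

open Classical in
/-- Move up two steps along the parent function `p` as long as the parent satisfies `B`. -/
noncomputable def groupRep {V : Type*} (B : V → Prop) (p : V → V) (d : V → ℕ)
    (h : ∀ v, B (p v) → d (p (p v)) < d v) (v : V) : V :=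
  if _ : B (p v) then groupRep B p d h (p (p v)) else v
termination_by d v
decreasing_by exact h v ‹_›

theorem groupRep_of_not {V : Type*} {B : V → Prop} {p : V → V} {d : V → ℕ}
    (h : ∀ v, B (p v) → d (p (p v)) < d v) {v : V} (hB : ¬ B (p v)) :
    groupRep B p d h v = v := by
  rw [groupRep, dif_neg hB]

theorem groupRep_of_pos {V : Type*} {B : V → Prop} {p : V → V} {d : V → ℕ}
    (h : ∀ v, B (p v) → d (p (p v)) < d v) {v : V} (hB : B (p v)) :
    groupRep B p d h v = groupRep B p d h (p (p v)) := by
  rw [groupRep, dif_pos hB]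

theorem depth_groupRep_le {V : Type*} {B : V → Prop} {p : V → V} {d : V → ℕ}
    (h : ∀ v, B (p v) → d (p (p v)) < d v) (v : V) :
    d (groupRep B p d h v) ≤ d v := by
  by_cases hB : B (p v)
  · rw [groupRep_of_pos h hB]
    exact (depth_groupRep_le h (p (p v))).trans (h v hB).le
  · rw [groupRep_of_not h hB]
termination_by d v
decreasing_by exact h v hB

/-- **Grósz–Janzer–Nagy, Claim in Section 2.** Let `F` be a blow-up of a finite tree
`T` (with independent sets `I(u) = π⁻¹(u)`, all nonempty since `π` is surjective),
and suppose `F` is `r`-degenerate.  Then there are positive integers `t ≥ r` and `k`,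
an `(r,t)`-blownup tree `L` with associated sets `X_1, …, X_k`, `Y_0, …, Y_k`, and an
embedding `φ` of `F` into `L` as a subgraph such that the image of each `I(u)` is
contained in a single `Y_i`. -/
theorem blowup_embeds_in_blownup_tree {W : Type} [Fintype W] {V : Type}
    (T : SimpleGraph V) (hT : T.IsTree) (F : SimpleGraph W) (π : W → V)
    (hsurj : Function.Surjective π)
    (hadj : ∀ w w', F.Adj w w' ↔ T.Adj (π w) (π w'))
    (r : ℕ) (hr : 1 ≤ r) (hdeg : Degenerate r F) :
    ∃ t k : ℕ, r ≤ t ∧ 1 ≤ k ∧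
      ∃ (Z : Type) (L : SimpleGraph Z) (Y : Fin (k + 1) → Finset Z)
        (X : Fin k → Finset Z),
        BlownupTreeData r t k L Y X ∧
        ∃ φ : W → Z, Function.Injective φ ∧
          (∀ ⦃a b⦄, F.Adj a b → L.Adj (φ a) (φ b)) ∧
          ∀ u : V, ∃ i : Fin (k + 1), ∀ w : W, π w = u → φ w ∈ Y i := by
  classical
  have : Finite V := Finite.of_surjective π hsurj
  have : Fintype V := Fintype.ofFinite V
  have : Nonempty V := hT.connected.nonempty
  let B : V → Prop := fun v => r < (π ⁻¹' {v}).ncard ∧ ∃ u, T.Adj u v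
  have hN : ∀ v, B v → (π ⁻¹' (T.neighborSet v)).ncard ≤ r := fun v hv =>
    hdeg.card_le_of_complete (A := π ⁻¹' {v})
      (fun a ha b hb => (hadj a b).2 ((show π a = v from ha) ▸ hb)) hv.1
  have hBadj : ∀ u v, T.Adj u v → B u → ¬ B v := by
    intro u v huv hu hv
    have hsub : π ⁻¹' {v} ⊆ π ⁻¹' T.neighborSet u :=
      Set.preimage_mono (Set.singleton_subset_iff.2 huv)
    exact (hv.1.trans_le (Set.ncard_le_ncard hsub (Set.toFinite _))).not_ge (hN u hu)
  obtain ⟨root, hroot⟩ : ∃ v, ¬ B v := by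
    by_contra! hB
    obtain ⟨v⟩ := ‹Nonempty V›
    obtain ⟨u, huv⟩ := (hB v).2
    exact hBadj u v huv (hB u) (hB v)
  obtain ⟨p, d, hp, hpd, hedge⟩ := hT.exists_parent root
  have hstep : ∀ v, B (p v) → d (p (p v)) < d v := by
    intro v hv
    have hv' : v ≠ root := by rintro rfl; exact hroot (hp ▸ hv)
    have hpv : p v ≠ root := fun h => hroot (h ▸ hv)
    exact (hpd _ hpv).2.trans (hpd _ hv').2
  let rep : V → V := groupRep B p d hstep
  have hrepB : ∀ v, B (p v) → rep v = rep (p (p v)) := fun v => groupRep_of_pos hstep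
  have hrep : ∀ v, ¬ B (p v) → rep v = v := fun v => groupRep_of_not hstep
  let φ : W → Fin r ⊕ V × (W ⊕ Fin r) := fun w => Sum.inr (rep (π w), Sum.inl w)
  have hφ : Function.Injective φ := fun a b h => by
    simp only [φ, Sum.inr.injEq, Prod.mk.injEq, Sum.inl.injEq] at h
    exact h.2
  let Y₀ : Finset (Fin r ⊕ V × (W ⊕ Fin r)) := Finset.univ.image Sum.inl
  let Y : V → Finset (Fin r ⊕ V × (W ⊕ Fin r)) :=
    fun v => Finset.univ.image fun s => Sum.inr (v, s)
  have hY₀ : Y₀.card = r := by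
    simp [Y₀, Finset.card_image_of_injective _ Sum.inl_injective]
  have hY : ∀ v, (Y v).card = Fintype.card W + r := by
    intro v
    rw [Finset.card_image_of_injective _ fun a b h => by simpa using h]
    simp
  have hφY : ∀ w, φ w ∈ Y (rep (π w)) := fun w => by simp [φ, Y]
  -- `X v` contains the images of the fibres that must be joined to the part of `v`.
  have hX : ∀ v, ∃ X : Finset (Fin r ⊕ V × (W ⊕ Fin r)), X.card = r ∧
      (X ⊆ Y₀ ∨ ∃ u, d u < d v ∧ X ⊆ Y u) ∧
      (B v → ∀ w, T.Adj (π w) v → φ w ∈ X) ∧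
      (v ≠ root → ¬ B v → ¬ B (p v) → ∀ w, π w = p v → φ w ∈ X) := by
    intro v
    by_cases hv : v = root
    · subst hv
      exact ⟨Y₀, hY₀, Or.inl subset_rfl, fun h => absurd h hroot, fun h => absurd rfl h⟩
    have hlt : d (rep (p v)) < d v := (depth_groupRep_le hstep _).trans_lt (hpd v hv).2
    have extend : ∀ S : Set W, S.ncard ≤ r → (∀ w ∈ S, rep (π w) = rep (p v)) →
        ∃ X : Finset (Fin r ⊕ V × (W ⊕ Fin r)), X.card = r ∧ X ⊆ Y (rep (p v)) ∧
          ∀ w ∈ S, φ w ∈ X := by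
      intro S hS hSrep
      obtain ⟨X, h₁, h₂, h₃⟩ := Finset.exists_subsuperset_card_eq
        (s := S.toFinset.image φ) (t := Y (rep (p v))) (n := r) (by
          intro z hz
          obtain ⟨w, hw, rfl⟩ := Finset.mem_image.1 hz
          rw [← hSrep w (Set.mem_toFinset.1 hw)]
          exact hφY w)
        (Finset.card_image_le.trans (by rwa [← Set.ncard_eq_toFinset_card'])) (by rw [hY]; lia)
      exact ⟨X, h₃, h₂, fun w hw => h₁ (Finset.mem_image_of_mem _ (Set.mem_toFinset.2 hw))⟩
    by_cases hBv : B v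
    · obtain ⟨X, hXc, hXY, hXS⟩ := extend (π ⁻¹' T.neighborSet v) (hN v hBv) (by
        intro w hw
        rcases hedge v (π w) hw with ⟨-, h⟩ | ⟨-, h⟩
        · rw [hrepB _ (h ▸ hBv), h]
        · rw [h])
      exact ⟨X, hXc, Or.inr ⟨_, hlt, hXY⟩, fun _ w hw => hXS w hw.symm, fun _ h => absurd hBv h⟩
    by_cases hBp : B (p v)
    · exact ⟨Y₀, hY₀, Or.inl subset_rfl, fun h => absurd h hBv, fun _ _ h => absurd hBp h⟩
    · obtain ⟨X, hXc, hXY, hXS⟩ := extend (π ⁻¹' {p v})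
        (not_lt.1 fun h => hBp ⟨h, v, (hpd v hv).1.symm⟩) (fun w hw => congrArg rep hw)
      exact ⟨X, hXc, Or.inr ⟨_, hlt, hXY⟩, fun h => absurd h hBv, fun _ _ _ w hw => hXS w hw⟩
  choose X hXc hXY hXB hXp using hX
  obtain ⟨k, hk, L, Y', X', hL, hY', hLadj⟩ := exists_blownupTreeData d Y₀ Y X
    (fun v => by simp [Finset.disjoint_left, Y₀, Y])
    (fun u v huv => by
      rw [Finset.disjoint_left]
      simp only [Y, Finset.mem_image, Finset.mem_univ, true_and]
      rintro _ ⟨s, rfl⟩ ⟨s', h⟩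
      simp only [Sum.inr.injEq, Prod.mk.injEq] at h
      exact huv h.1.symm) hY₀ hY
    (by
      rintro (i | ⟨v, s⟩)
      · left; simp [Y₀]
      · right; exact ⟨v, by simp [Y]⟩) hXc hXY
  have hmap : ∀ a b, F.Adj a b → π b ≠ root → p (π b) = π a → L.Adj (φ a) (φ b) := by
    intro a b hab hb hpb
    have hT' := (hadj a b).1 hab
    by_cases hBa : B (π a)
    · have ha : rep (π a) = π a := hrep _ fun h => by
        have haroot : π a ≠ root := fun h' => hroot (h' ▸ hBa)
        exact hBadj _ _ (hpd _ haroot).1 h hBa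
      exact (hLadj (π a) _ (hXB _ hBa b hT'.symm) _ (by simpa only [ha] using hφY a)).symm
    · have hb' : rep (π b) = π b := hrep _ (by rwa [hpb])
      have hφb : φ b ∈ Y (π b) := by simpa only [hb'] using hφY b
      by_cases hBb : B (π b)
      · exact hLadj (π b) _ (hXB _ hBb a hT') _ hφb
      · exact hLadj (π b) _ (hXp _ hb hBb (by rwa [hpb]) a hpb.symm) _ hφb
  refine ⟨Fintype.card W + r, k, by lia, hk, _, L, Y', X', hL, φ, hφ, ?_, ?_⟩
  · intro a b hab
    rcases hedge _ _ ((hadj a b).1 hab) with ⟨h, h'⟩ | ⟨h, h'⟩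
    · exact hmap a b hab h h'
    · exact (hmap b a hab.symm h h').symm
  · intro u
    obtain ⟨i, hi⟩ := hY' (rep u)
    exact ⟨i, fun w hw => by rw [hi, ← hw]; exact hφY w⟩
end

section
/- Every (r,t)-blownup tree (of any size k) is r-degenerate, i.e., every nonempty subgraph of an (r,t)-blownup tree has a vertex of degree at most r. -/
/-- Every `(r,t)`-blownup tree is `r`-degenerate: each of its nonempty subgraphs
has a vertex of degree at most `r`. -/
theorem blownup_tree_degenerate (r t k : ℕ) (hr : 1 ≤ r) (hrt : r ≤ t) (hk : 1 ≤ k)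
    {V : Type} (L : SimpleGraph V) (hL : IsBlownupTree r t k L) :
    Degenerate r L := by
  obtain ⟨Y, X, hdisj, -, -, hcover, hXcard, -, hXsub, hadj⟩ := hL
  intro H hne
  choose f hf using hcover
  have hf_unique : ∀ v i, v ∈ Y i → f v = i := fun v i hv => by
    by_contra h
    exact Finset.disjoint_left.mp (hdisj _ _ h) (hf v) hv
  -- A vertex of `H` in the last part that `H` meets.
  obtain ⟨_, ⟨v, hv, rfl⟩, hmax⟩ :=
    Set.exists_max_image (f '' H.verts) id (Set.toFinite _) (hne.image f)
  -- Every neighbour of `v` in `H` lies in the set to which the part of `v` is joined.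
  have hnbr : ∀ u ∈ H.neighborSet v, ∃ i : Fin k, u ∈ X i ∧ f v = i.succ := by
    intro u hu
    obtain ⟨i, ⟨hvX, huY⟩ | ⟨huX, hvY⟩⟩ := (hadj v u).mp (H.adj_sub hu)
    · obtain ⟨j, hji, hXY⟩ := hXsub i
      have hle : f u ≤ f v := hmax _ ⟨u, H.edge_vert (H.adj_symm hu), rfl⟩
      rw [hf_unique u _ huY, hf_unique v _ (hXY hvX), Fin.le_def, Fin.val_succ] at hle
      omega
    · exact ⟨i, huX, hf_unique v _ hvY⟩
  refine ⟨v, hv, ?_⟩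
  obtain hempty | ⟨u, hu⟩ := (H.neighborSet v).eq_empty_or_nonempty
  · simp [hempty]
  · obtain ⟨i, -, hi⟩ := hnbr u hu
    have hsub : H.neighborSet v ⊆ (X i : Set V) := by
      intro w hw
      obtain ⟨j, hwj, hj⟩ := hnbr w hw
      have hji : j = i := Fin.succ_injective _ (hj.symm.trans hi)
      exact hji ▸ hwj
    calc (H.neighborSet v).ncard ≤ (X i : Set V).ncard :=
          Set.ncard_le_ncard hsub (X i).finite_toSet
      _ = r := by rw [Set.ncard_coe_finset, hXcard]
end
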